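/- arXiv:2108.07054 — 2 statements merged into one kernel-verified Lean document; each statement's English description precedes it below -/
import Mathlib

section
/- Let p and q be monic real polynomials of degree m, each with all roots real, such that the sum of the roots of q equals 0. For t > 0 let q_t(x) = t^m q(x/t) (the monic polynomial whose roots are t times the roots of q), and let q_0(x) = x^m. Define r_t = [p ⊞_m q_t]. Then for all real t ≥ s ≥ 0, r_t and r_s have all roots real and the multiset of roots of r_t majorizes the multiset of roots of r_s. -/
open Polynomial

/-- The symmetric additive convolution of two polynomials of degree (at most) `m`:
`[p ⊞_m q](x) = (1/m!) ∑_{i=0}^m p^{(i)}(x) · q^{(m-i)}(0)`. -/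
noncomputable def boxplus (m : ℕ) (p q : ℝ[X]) : ℝ[X] :=
  (m.factorial : ℝ)⁻¹ •
    ∑ i ∈ Finset.range (m + 1),
      C ((Polynomial.derivative^[m - i] q).eval 0) * Polynomial.derivative^[i] p

/-- A multiset `x` of reals majorizes a multiset `y` of reals (of the same size) if the
sum of the `k` largest elements of `x` is at least the sum of the `k` largest elements
of `y` for every `k`, with equality of the total sums. -/
def Majorizes (x y : Multiset ℝ) : Prop :=
  Multiset.card x = Multiset.card y ∧ x.sum = y.sum ∧
    ∀ k : ℕ,
      ((y.sort (· ≤ ·)).drop (Multiset.card y - k)).sum ≤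
        ((x.sort (· ≤ ·)).drop (Multiset.card x - k)).sum

/-! ### Polynomials without zeros in the open upper half plane -/

/-- The polynomial `P` has no zero in the open upper half plane. -/
def UpperFree (P : ℂ[X]) : Prop := ∀ z : ℂ, 0 < z.im → P.eval z ≠ 0

theorem mul_normSq_sum_le {y : ℝ} (s : Multiset ℂ)
    (hs : ∀ w ∈ s, y * Complex.normSq w ≤ -w.im) (hy : 0 < y) :
    y * Complex.normSq s.sum ≤ s.card * (-s.sum.im) := by
  induction s using Multiset.induction_on with
  | empty => simp
  | cons w s ih =>
    have hw := hs w (Multiset.mem_cons_self w s)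
    have ih := ih fun v hv => hs v (Multiset.mem_cons_of_mem hv)
    rcases Nat.eq_zero_or_pos s.card with h0 | hpos
    · rw [Multiset.card_eq_zero] at h0
      subst h0
      simpa using hw
    · have hn : (0 : ℝ) < s.card := by exact_mod_cast hpos
      rw [Multiset.sum_cons, Multiset.card_cons, Nat.cast_succ]
      generalize s.sum = S at *
      generalize (s.card : ℝ) = n at *
      simp only [Complex.normSq_apply, Complex.add_re, Complex.add_im] at *
      have hsq : 0 ≤ y * ((S.re - n * w.re) ^ 2 + (S.im - n * w.im) ^ 2) := by positivity
      have key : n * (2 * y * (S.re * w.re + S.im * w.im)) ≤ n * (-S.im + n * (-w.im)) := by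
        nlinarith [mul_le_mul_of_nonneg_left hw (sq_nonneg n)]
      have := le_of_mul_le_mul_left key hn
      nlinarith

theorem logDeriv_mem_disk {P : ℂ[X]} (hP : UpperFree P) {z : ℂ} (hz : 0 < z.im) :
    z.im * Complex.normSq (P.derivative.eval z / P.eval z) ≤
      P.natDegree * (-(P.derivative.eval z / P.eval z).im) := by
  have hs : P.Splits := IsAlgClosed.splits P
  rw [hs.eval_derivative_div_eval_of_ne_zero (hP z hz)]
  have hcard : P.natDegree = (P.roots.map fun a => 1 / (z - a)).card := by
    rw [Multiset.card_map]
    exact (splits_iff_card_roots.mp hs).symm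
  rw [hcard]
  refine mul_normSq_sum_le _ ?_ hz
  intro w hw
  obtain ⟨a, ha, rfl⟩ := Multiset.mem_map.mp hw
  have ha0 : a.im ≤ 0 := by
    by_contra! h
    exact hP a h (isRoot_of_mem_roots ha)
  have hne : 0 < Complex.normSq (z - a) := by
    rw [Complex.normSq_pos]
    intro h
    have := congrArg Complex.im h
    simp at this
    linarith
  rw [one_div, Complex.normSq_inv, Complex.inv_im]
  rw [← div_eq_mul_inv, ← neg_div, neg_neg]
  gcongr
  simp
  linarith

theorem logDeriv_im_neg {P : ℂ[X]} (hP : UpperFree P) (hd : P.natDegree ≠ 0) {z : ℂ}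
    (hz : 0 < z.im) : (P.derivative.eval z / P.eval z).im < 0 := by
  have hs : P.Splits := IsAlgClosed.splits P
  rw [hs.eval_derivative_div_eval_of_ne_zero (hP z hz), ← Complex.coe_imAddGroupHom,
    map_multiset_sum, Multiset.map_map]
  have hneg : ∀ a ∈ P.roots, (Complex.imAddGroupHom ∘ fun a => 1 / (z - a)) a < 0 := by
    intro a ha
    have ha0 : a.im ≤ 0 := by
      by_contra! h
      exact hP a h (isRoot_of_mem_roots ha)
    have hne : 0 < Complex.normSq (z - a) := by
      rw [Complex.normSq_pos]
      intro h
      have := congrArg Complex.im h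
      simp at this
      linarith
    simp only [Function.comp_apply, Complex.coe_imAddGroupHom, one_div, Complex.inv_im]
    apply div_neg_of_neg_of_pos _ hne
    simp
    linarith
  have hcard : P.roots ≠ 0 := by
    rw [Ne, ← Multiset.card_eq_zero, splits_iff_card_roots.mp hs]
    exact hd
  have := Multiset.sum_lt_sum_of_nonempty hcard hneg
  simpa using this

theorem UpperFree.derivative {P : ℂ[X]} (hP : UpperFree P) (hd : P.natDegree ≠ 0) :
    UpperFree P.derivative := by
  intro z hz h
  simpa [h] using logDeriv_im_neg hP hd hz

theorem UpperFree.sub_C_mul_derivative {P : ℂ[X]} (hP : UpperFree P) (ε : ℝ) :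
    UpperFree (P - C (ε : ℂ) * P.derivative) := by
  intro z hz h
  by_cases hd : P.natDegree = 0
  · rw [natDegree_eq_zero] at hd
    obtain ⟨c, rfl⟩ := hd
    exact hP z hz (by simpa using h)
  · have h1 := logDeriv_im_neg hP hd hz
    have h2 : (ε : ℂ) * (P.derivative.eval z / P.eval z) = 1 := by
      rw [mul_div_assoc', div_eq_one_iff_eq (hP z hz)]
      simp at h
      linear_combination -h
    have h3 := congrArg Complex.im h2
    have h4 := congrArg Complex.re h2
    simp only [Complex.re_ofReal_mul, Complex.im_ofReal_mul, Complex.one_re, Complex.one_im]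
      at h3 h4
    rcases mul_eq_zero.mp h3 with h5 | h5
    · simp [h5] at h4
    · exact h1.ne h5

/-- The polar derivative of `P`, viewed as a polynomial of degree at most `m + 1`, with respect to
the point `ζ`, normalised by `m + 1`. -/
noncomputable def polarDerivative (m : ℕ) (ζ : ℂ) (P : ℂ[X]) : ℂ[X] :=
  P + C ((m + 1 : ℂ)⁻¹) * ((C ζ - X) * P.derivative)

theorem natDegree_polarDerivative_le {m : ℕ} {ζ : ℂ} {P : ℂ[X]} (hd : P.natDegree ≤ m + 1) :
    (polarDerivative m ζ P).natDegree ≤ m := by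
  rw [natDegree_le_iff_coeff_eq_zero]
  intro k hk
  obtain ⟨j, rfl⟩ : ∃ j, k = j + 1 := ⟨k - 1, by omega⟩
  have h2 : P.coeff (j + 2) = 0 := coeff_eq_zero_of_natDegree_lt (by omega)
  simp only [polarDerivative, coeff_add, coeff_C_mul, sub_mul, coeff_sub, coeff_X_mul,
    coeff_derivative]
  rw [show j + 1 + 1 = j + 2 from rfl, h2]
  by_cases hj : j = m
  · subst hj
    have : (j + 1 : ℂ) ≠ 0 := by exact_mod_cast Nat.succ_ne_zero j
    field_simp
    ring
  · have : P.coeff (j + 1) = 0 := coeff_eq_zero_of_natDegree_lt (by omega)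
    simp [this]

/-- **Laguerre's theorem** for the upper half plane. -/
theorem UpperFree.polarDerivative {m : ℕ} {ζ : ℂ} {P : ℂ[X]} (hP : UpperFree P)
    (hd : P.natDegree ≤ m + 1) (hζ : 0 < ζ.im) : UpperFree (polarDerivative m ζ P) := by
  intro z hz h
  have hz0 := hP z hz
  have hm : (m + 1 : ℂ) ≠ 0 := by exact_mod_cast Nat.succ_ne_zero m
  have hdisk := logDeriv_mem_disk hP hz
  set w := P.derivative.eval z / P.eval z with hw
  have hw1 : (z - ζ) * w = m + 1 := by
    rw [hw, mul_div_assoc', div_eq_iff hz0]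
    simp [_root_.polarDerivative] at h
    field_simp at h
    linear_combination -h
  have hd' : (P.natDegree : ℝ) ≤ m + 1 := by exact_mod_cast hd
  have hne : w ≠ 0 := by
    rintro h0
    rw [h0, mul_zero] at hw1
    exact hm hw1.symm
  have hn : 0 < Complex.normSq w := Complex.normSq_pos.mpr hne
  have e1 : z - ζ = (m + 1 : ℝ) * w⁻¹ := by
    rw [eq_mul_inv_iff_mul_eq₀ hne, hw1]
    push_cast
    ring
  have e2 := congrArg Complex.im e1
  rw [Complex.im_ofReal_mul, Complex.inv_im, Complex.sub_im, mul_div_assoc', eq_div_iff hn.ne']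
    at e2
  have : 0 < ζ.im * Complex.normSq w := mul_pos hζ hn
  have him : 0 ≤ -w.im := by
    have : 0 ≤ z.im * Complex.normSq w := by positivity
    by_contra! hc
    have : (P.natDegree : ℝ) * (-w.im) ≤ 0 :=
      mul_nonpos_of_nonneg_of_nonpos (Nat.cast_nonneg _) hc.le
    have : 0 < z.im * Complex.normSq w := by positivity
    linarith
  nlinarith [mul_le_mul_of_nonneg_right hd' him]

/-! ### The convolution over the complex numbers -/

/-- The value at `x` of the symmetric additive convolution of two complex polynomials. -/
noncomputable def boxplusEval (m : ℕ) (P Q : ℂ[X]) (x : ℂ) : ℂ :=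
  (m.factorial : ℂ)⁻¹ *
    ∑ i ∈ Finset.range (m + 1),
      (Polynomial.derivative^[m - i] Q).eval 0 * (Polynomial.derivative^[i] P).eval x

theorem aeval_boxplus (m : ℕ) (p q : ℝ[X]) (x : ℂ) :
    aeval x (boxplus m p q) =
      boxplusEval m (p.map (algebraMap ℝ ℂ)) (q.map (algebraMap ℝ ℂ)) x := by
  simp only [boxplus, boxplusEval, map_smul, map_sum, map_mul, iterate_derivative_map, aeval_C,
    eval_map_algebraMap, Complex.real_smul]
  push_cast
  congr 1
  refine Finset.sum_congr rfl fun i _ => ?_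
  congr 1
  rw [← Complex.ofReal_zero, ← Complex.coe_algebraMap, aeval_algebraMap_apply, coe_aeval_eq_eval]

theorem iterate_derivative_polarDerivative_eval (m i : ℕ) (x β : ℂ) (P : ℂ[X]) :
    (Polynomial.derivative^[i] (polarDerivative m (x - β) P)).eval x =
      (m + 1 : ℂ)⁻¹ * ((m + 1 - i) * (Polynomial.derivative^[i] P).eval x -
        β * (Polynomial.derivative^[i + 1] P).eval x) := by
  have hm : (m + 1 : ℂ) ≠ 0 := by exact_mod_cast Nat.succ_ne_zero m
  rw [polarDerivative, iterate_map_add, iterate_derivative_C_mul, sub_mul,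
    iterate_derivative_sub, iterate_derivative_C_mul, mul_comm X, iterate_derivative_mul_X]
  rcases i with _ | i
  · simp
    field_simp
    ring
  · simp
    field_simp
    ring

theorem boxplusEval_X_sub_C_mul {m : ℕ} (P : ℂ[X]) {Q : ℂ[X]} (hQ : Q.natDegree ≤ m) (x β : ℂ) :
    boxplusEval (m + 1) P ((X - C β) * Q) x =
      boxplusEval m (polarDerivative m (x - β) P) Q x := by
  have hder : ∀ j : ℕ, (Polynomial.derivative^[j + 1] ((X - C β) * Q)).eval 0 =
      (j + 1) * (Polynomial.derivative^[j] Q).eval 0 -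
        β * (Polynomial.derivative^[j + 1] Q).eval 0 := by
    intro j
    rw [sub_mul, iterate_derivative_sub, iterate_derivative_C_mul, mul_comm X,
      iterate_derivative_mul_X]
    simp
  have hm : (m + 1 : ℂ) ≠ 0 := by exact_mod_cast Nat.succ_ne_zero m
  have hm' : (m.factorial : ℂ) ≠ 0 := by exact_mod_cast m.factorial_ne_zero
  have h0 : Polynomial.derivative^[m + 1] Q = 0 := iterate_derivative_eq_zero (by omega)
  unfold boxplusEval
  simp only [iterate_derivative_polarDerivative_eval]
  have hA : ∑ i ∈ Finset.range (m + 1 + 1),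
      (Polynomial.derivative^[m + 1 - i] ((X - C β) * Q)).eval 0 *
        (Polynomial.derivative^[i] P).eval x =
      ∑ i ∈ Finset.range (m + 1), (Polynomial.derivative^[m - i] Q).eval 0 *
        ((m + 1 - i) * (Polynomial.derivative^[i] P).eval x -
          β * (Polynomial.derivative^[i + 1] P).eval x) := by
    have e1 : ∑ i ∈ Finset.range (m + 1 + 1),
        (Polynomial.derivative^[m + 1 - i] ((X - C β) * Q)).eval 0 *
          (Polynomial.derivative^[i] P).eval x =
        ∑ i ∈ Finset.range (m + 1), (m + 1 - i) * (Polynomial.derivative^[m - i] Q).eval 0 *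
          (Polynomial.derivative^[i] P).eval x -
        ∑ i ∈ Finset.range (m + 1 + 1), β * (Polynomial.derivative^[m + 1 - i] Q).eval 0 *
          (Polynomial.derivative^[i] P).eval x := by
      rw [Finset.sum_range_succ, Finset.sum_range_succ _ (m + 1), ← sub_sub,
        ← Finset.sum_sub_distrib, sub_eq_add_neg _ (β * _ * _)]
      congr 1
      · refine Finset.sum_congr rfl fun i hi => ?_
        have hi' : i ≤ m := by simpa [Nat.lt_succ_iff] using hi
        rw [show m + 1 - i = (m - i) + 1 by omega, hder, Nat.cast_sub hi']
        ring
      · simp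
    rw [e1, Finset.sum_range_succ' _ (m + 1)]
    simp only [Nat.sub_zero, h0, Nat.add_sub_add_right, eval_zero, mul_zero, zero_mul, add_zero]
    rw [← Finset.sum_sub_distrib]
    exact Finset.sum_congr rfl fun i _ => by ring
  rw [hA, Nat.factorial_succ]
  push_cast
  rw [mul_inv, mul_comm (m + 1 : ℂ)⁻¹, mul_assoc, Finset.mul_sum]
  congr 1
  exact Finset.sum_congr rfl fun i _ => by ring

theorem boxplusEval_succ_of_natDegree_le {m : ℕ} (P : ℂ[X]) {Q : ℂ[X]} (hQ : Q.natDegree ≤ m)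
    (x : ℂ) :
    boxplusEval (m + 1) P Q x = boxplusEval m (C (m + 1 : ℂ)⁻¹ * P.derivative) Q x := by
  have h0 : Polynomial.derivative^[m + 1] Q = 0 := iterate_derivative_eq_zero (by omega)
  unfold boxplusEval
  rw [Finset.sum_range_succ']
  simp only [Nat.sub_zero, h0, Nat.add_sub_add_right, eval_zero, zero_mul, add_zero,
    iterate_derivative_C_mul, ← Function.iterate_succ_apply, eval_mul, eval_C]
  rw [Nat.factorial_succ]
  push_cast
  rw [mul_inv, mul_comm (m + 1 : ℂ)⁻¹, mul_assoc, Finset.mul_sum]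
  congr 1
  exact Finset.sum_congr rfl fun i _ => by ring

/-- **Grace–Walsh–Szegő** in the form needed for the symmetric additive convolution. -/
theorem boxplusEval_ne_zero {P : ℂ[X]} (s : Multiset ℂ) (hP : UpperFree P)
    (hd : P.natDegree ≤ s.card) {x : ℂ} (hs : ∀ β ∈ s, β.im < x.im) :
    boxplusEval s.card P (s.map fun β => X - C β).prod x ≠ 0 := by
  induction s using Multiset.induction_on generalizing P with
  | empty =>
    obtain ⟨c, rfl⟩ := natDegree_eq_zero.mp (Nat.le_zero.mp hd)
    have := hP Complex.I (by simp)
    simpa [boxplusEval] using this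
  | cons β s ih =>
    rw [Multiset.map_cons, Multiset.prod_cons, Multiset.card_cons,
      boxplusEval_X_sub_C_mul _ (natDegree_multiset_prod_X_sub_C_eq_card s).le]
    rw [Multiset.card_cons] at hd
    have hβ : 0 < (x - β).im := by
      have := hs β (Multiset.mem_cons_self β s)
      simp
      linarith
    exact ih (hP.polarDerivative hd hβ) (natDegree_polarDerivative_le hd)
      fun b hb => hs b (Multiset.mem_cons_of_mem hb)

/-! ### Real-rooted polynomials -/

theorem aeval_conj_real (P : ℝ[X]) (z : ℂ) :
    aeval (starRingEnd ℂ z) P = starRingEnd ℂ (aeval z P) := by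
  have := aeval_algHom_apply Complex.conjAe.toAlgHom z P
  simpa using this

theorem upperFree_map_iff {P : ℝ[X]} :
    UpperFree (P.map (algebraMap ℝ ℂ)) ↔ ∀ z : ℂ, 0 < z.im → aeval z P ≠ 0 := by
  simp [UpperFree, eval_map_algebraMap]

theorem UpperFree.of_mul_right {P Q : ℂ[X]} (h : UpperFree (P * Q)) : UpperFree Q := fun z hz h0 =>
  h z hz (by rw [eval_mul, h0, mul_zero])

theorem exists_real_root_of_upperFree {P : ℝ[X]} (hP : UpperFree (P.map (algebraMap ℝ ℂ)))
    (hd : P.natDegree ≠ 0) : ∃ a : ℝ, P.IsRoot a := by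
  have hdeg : P.degree ≠ 0 := fun h => hd (natDegree_eq_of_degree_eq_some h)
  obtain ⟨z, hz⟩ := IsAlgClosed.exists_aeval_eq_zero ℂ P hdeg
  rw [upperFree_map_iff] at hP
  have him : z.im = 0 := by
    rcases lt_trichotomy z.im 0 with h | h | h
    · exact absurd (by rw [aeval_conj_real, hz, map_zero])
        (hP (starRingEnd ℂ z) (by simpa using h))
    · exact h
    · exact absurd hz (hP z h)
  refine ⟨z.re, ?_⟩
  have hz' : z = algebraMap ℝ ℂ z.re := Complex.ext (by simp) (by simp [him])
  rw [hz', aeval_algebraMap_apply, coe_aeval_eq_eval] at hz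
  simpa using hz

theorem card_roots_of_upperFree {P : ℝ[X]} (hP : UpperFree (P.map (algebraMap ℝ ℂ))) :
    Multiset.card P.roots = P.natDegree := by
  induction hn : P.natDegree generalizing P with
  | zero =>
    have := card_roots' P
    omega
  | succ n ih =>
    obtain ⟨a, ha⟩ := exists_real_root_of_upperFree hP (by omega)
    obtain ⟨Q, rfl⟩ := dvd_iff_isRoot.mpr ha
    have hne : (X - C a) * Q ≠ 0 := by
      rintro h
      simp [h] at hn
    have hQ : Q ≠ 0 := right_ne_zero_of_mul hne
    rw [Polynomial.map_mul] at hP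
    rw [natDegree_mul (X_sub_C_ne_zero a) hQ, natDegree_X_sub_C] at hn
    rw [roots_mul hne, roots_X_sub_C, Multiset.card_add, Multiset.card_singleton,
      ih hP.of_mul_right (by omega)]
    omega

theorem eq_prod_of_card_roots {P : ℝ[X]} (hP : P.Monic)
    (h : Multiset.card P.roots = P.natDegree) : (P.roots.map fun a => X - C a).prod = P :=
  prod_multiset_X_sub_C_of_monic_of_roots_card_eq hP h

theorem upperFree_of_card_roots {P : ℝ[X]} (hP : P.Monic)
    (h : Multiset.card P.roots = P.natDegree) : UpperFree (P.map (algebraMap ℝ ℂ)) := by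
  rw [← eq_prod_of_card_roots hP h]
  intro z hz
  rw [Polynomial.map_multiset_prod, eval_multiset_prod, Multiset.map_map, Multiset.map_map]
  refine Multiset.prod_ne_zero fun h0 => ?_
  obtain ⟨a, -, ha⟩ := Multiset.mem_map.mp h0
  have := congrArg Complex.im ha
  simp at this
  exact hz.ne' this

/-! ### Elementary properties of the convolution -/

theorem boxplus_add (m : ℕ) (p q r : ℝ[X]) :
    boxplus m p (q + r) = boxplus m p q + boxplus m p r := by
  simp only [boxplus, iterate_map_add, eval_add, C_add, add_mul, Finset.sum_add_distrib, smul_add]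

theorem boxplus_C_mul (m : ℕ) (p q : ℝ[X]) (a : ℝ) :
    boxplus m p (C a * q) = C a * boxplus m p q := by
  simp only [boxplus, iterate_derivative_C_mul, eval_mul, eval_C, C_mul, mul_assoc,
    ← Finset.mul_sum, mul_smul_comm]

theorem boxplusEval_add (m : ℕ) (P Q R : ℂ[X]) (x : ℂ) :
    boxplusEval m P (Q + R) x = boxplusEval m P Q x + boxplusEval m P R x := by
  simp only [boxplusEval, iterate_map_add, eval_add, add_mul, Finset.sum_add_distrib, mul_add]

theorem boxplusEval_C_mul (m : ℕ) (P Q : ℂ[X]) (a x : ℂ) :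
    boxplusEval m P (C a * Q) x = a * boxplusEval m P Q x := by
  simp only [boxplusEval, iterate_derivative_C_mul, eval_mul, eval_C]
  rw [mul_left_comm, Finset.mul_sum _ _ a]
  simp only [mul_assoc]

theorem boxplus_monic_natDegree {m d : ℕ} {p q : ℝ[X]} (hp : p.Monic) (hpd : p.natDegree = m)
    (hq : q.Monic) (hqd : q.natDegree = d) (hd : d ≤ m) :
    (boxplus m p q).Monic ∧ (boxplus m p q).natDegree = d := by
  have hle : (boxplus m p q).natDegree ≤ d := by
    refine (natDegree_smul_le _ _).trans (natDegree_sum_le_of_forall_le _ _ fun i hi => ?_)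
    have hi' : i ≤ m := by simpa [Nat.lt_succ_iff] using hi
    by_cases h : m - i ≤ d
    · refine (natDegree_C_mul_le _ _).trans ((natDegree_iterate_derivative p i).trans ?_)
      omega
    · rw [iterate_derivative_eq_zero (by omega)]
      simp
  have hcoeff : (boxplus m p q).coeff d = 1 := by
    rw [boxplus, coeff_smul, finsetSum_coeff, Finset.sum_eq_single (m - d)]
    · rw [show m - (m - d) = d by omega, coeff_C_mul, ← coeff_zero_eq_eval_zero,
        coeff_iterate_derivative, coeff_iterate_derivative, show d + (m - d) = m by omega, zero_add,
        ← hqd, hq.coeff_natDegree, hqd, ← hpd, hp.coeff_natDegree, hpd, Nat.descFactorial_self,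
        nsmul_one, nsmul_one, smul_eq_mul, ← Nat.cast_mul]
      have h1 := Nat.factorial_mul_descFactorial (show m - d ≤ m by omega)
      rw [show m - (m - d) = d by omega] at h1
      rw [h1, inv_mul_cancel₀]
      exact_mod_cast m.factorial_ne_zero
    · intro i hi hne
      have hi' : i ≤ m := by simpa [Nat.lt_succ_iff] using hi
      by_cases h : m - i ≤ d
      · rw [coeff_C_mul, coeff_iterate_derivative, coeff_eq_zero_of_natDegree_lt (by omega)]
        simp
      · rw [iterate_derivative_eq_zero (by omega)]
        simp
    · intro h
      simp at h
  exact ⟨monic_of_natDegree_le_of_coeff_eq_one d hle hcoeff,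
    natDegree_eq_of_le_of_coeff_ne_zero hle (by rw [hcoeff]; exact one_ne_zero)⟩

theorem upperFree_boxplus {m : ℕ} {p q : ℝ[X]} (hp : p.Monic) (hq : q.Monic)
    (hpd : p.natDegree = m) (hqd : q.natDegree = m)
    (hproots : Multiset.card p.roots = m) (hqroots : Multiset.card q.roots = m) :
    UpperFree ((boxplus m p q).map (algebraMap ℝ ℂ)) := by
  rw [upperFree_map_iff]
  intro z hz
  have hq' := eq_prod_of_card_roots hq (by omega)
  have key := boxplusEval_ne_zero (q.roots.map fun a : ℝ => (a : ℂ)) (x := z)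
    (upperFree_of_card_roots hp (by omega)) (by simp [hqroots, hpd]) (by
      intro β hβ
      obtain ⟨a, -, rfl⟩ := Multiset.mem_map.mp hβ
      rwa [Complex.ofReal_im])
  rw [aeval_boxplus]
  convert key using 2
  · simp [hqroots]
  · conv_lhs => rw [← hq']
    rw [Polynomial.map_multiset_prod, Multiset.map_map, Multiset.map_map]
    simp

/-! ### Stable triples -/

/-- Three monic real polynomials of consecutive degrees such that
`F - (α + β) N + α β G`, `N - α G` and `G` have no zero in the open upper half plane whenever
`α` and `β` lie in the closed lower half plane. -/
structure StableTriple (n : ℕ) (F N G : ℝ[X]) : Prop where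
  monic_fst : F.Monic
  natDegree_fst : F.natDegree = n + 2
  monic_snd : N.Monic
  natDegree_snd : N.natDegree = n + 1
  monic_trd : G.Monic
  natDegree_trd : G.natDegree = n
  ne_zero_fst : ∀ α β z : ℂ, α.im ≤ 0 → β.im ≤ 0 → 0 < z.im →
    aeval z F - (α + β) * aeval z N + α * β * aeval z G ≠ 0
  ne_zero_snd : ∀ α z : ℂ, α.im ≤ 0 → 0 < z.im → aeval z N - α * aeval z G ≠ 0
  ne_zero_trd : ∀ z : ℂ, 0 < z.im → aeval z G ≠ 0

/-- The polynomial `F - (α + β) N + α β G`. -/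
noncomputable def pencil (F N G : ℝ[X]) (α β : ℝ) : ℝ[X] := F - C (α + β) * N + C (α * β) * G

theorem boxplus_two_roots (m : ℕ) (p h : ℝ[X]) (α β : ℝ) :
    boxplus m p ((X - C α) * ((X - C β) * h)) =
      pencil (boxplus m p (X * (X * h))) (boxplus m p (X * h)) (boxplus m p h) α β := by
  have : (X - C α) * ((X - C β) * h) =
      X * (X * h) + C (-(α + β)) * (X * h) + C (α * β) * h := by
    simp only [C_neg, C_add, C_mul]
    ring
  rw [this, boxplus_add, boxplus_add, boxplus_C_mul, boxplus_C_mul, pencil, C_neg]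
  ring

theorem pencil_monic_natDegree {n : ℕ} {F N G : ℝ[X]} (h : StableTriple n F N G) (α β : ℝ) :
    (pencil F N G α β).Monic ∧ (pencil F N G α β).natDegree = n + 2 := by
  have hle : (C (α * β) * G - C (α + β) * N).natDegree < F.natDegree := by
    rw [h.natDegree_fst]
    refine (natDegree_sub_le _ _).trans_lt (max_lt ?_ ?_)
    · exact (natDegree_C_mul_le _ _).trans_lt (by rw [h.natDegree_trd]; omega)
    · exact (natDegree_C_mul_le _ _).trans_lt (by rw [h.natDegree_snd]; omega)
  have e : pencil F N G α β = F + (C (α * β) * G - C (α + β) * N) := by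
    rw [pencil]
    ring
  rw [e]
  refine ⟨h.monic_fst.add_of_left (degree_lt_degree hle), ?_⟩
  rw [natDegree_add_eq_left_of_natDegree_lt hle, h.natDegree_fst]

theorem card_roots_pencil {n : ℕ} {F N G : ℝ[X]} (h : StableTriple n F N G) (α β : ℝ) :
    Multiset.card (pencil F N G α β).roots = n + 2 := by
  rw [card_roots_of_upperFree, (pencil_monic_natDegree h α β).2]
  rw [upperFree_map_iff]
  intro z hz
  have := h.ne_zero_fst α β z (by simp) (by simp) hz
  simpa [pencil] using this

theorem stableTriple_boxplus {n : ℕ} {p h : ℝ[X]} (hp : p.Monic) (hpd : p.natDegree = n + 2)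
    (hproots : Multiset.card p.roots = n + 2) (hh : h.Monic) (hhd : h.natDegree = n)
    (hhroots : Multiset.card h.roots = n) :
    StableTriple n (boxplus (n + 2) p (X * (X * h))) (boxplus (n + 2) p (X * h))
      (boxplus (n + 2) p h) := by
  have hXm : (X * h).Monic := monic_X.mul hh
  have hXd : (X * h).natDegree = n + 1 := by rw [natDegree_X_mul hh.ne_zero, hhd]
  have hXXm : (X * (X * h)).Monic := monic_X.mul hXm
  have hXXd : (X * (X * h)).natDegree = n + 2 := by rw [natDegree_X_mul hXm.ne_zero, hXd]
  obtain ⟨m1, d1⟩ := boxplus_monic_natDegree hp hpd hXXm hXXd le_rfl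
  obtain ⟨m2, d2⟩ := boxplus_monic_natDegree hp hpd hXm hXd (by omega)
  obtain ⟨m3, d3⟩ := boxplus_monic_natDegree hp hpd hh hhd (by omega)
  set P := p.map (algebraMap ℝ ℂ) with hP
  set s : Multiset ℂ := h.roots.map fun a : ℝ => (a : ℂ) with hs
  have hPu : UpperFree P := upperFree_of_card_roots hp (by omega)
  have hPd : P.natDegree = n + 2 := by rw [hP, natDegree_map, hpd]
  have hh' : h.map (algebraMap ℝ ℂ) = (s.map fun β => X - C β).prod := by
    conv_lhs => rw [← eq_prod_of_card_roots hh (by omega)]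
    rw [Polynomial.map_multiset_prod, Multiset.map_map, hs, Multiset.map_map]
    simp
  have hsc : s.card = n := by simp [hs, hhroots]
  have him : ∀ {z : ℂ}, 0 < z.im → ∀ β ∈ s, β.im < z.im := by
    intro z hz β hβ
    obtain ⟨a, -, rfl⟩ := Multiset.mem_map.mp hβ
    rwa [Complex.ofReal_im]
  have hPd1 : P.derivative.natDegree = n + 1 := by rw [natDegree_derivative, hPd]; rfl
  have hPd2 : P.derivative.derivative.natDegree = n := by rw [natDegree_derivative, hPd1]; rfl
  have hscale : ∀ {k : ℕ} {Q : ℂ[X]}, UpperFree Q → UpperFree (C ((k : ℂ) + 1)⁻¹ * Q) := by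
    intro k Q hQ z hz
    rw [eval_mul, eval_C]
    exact mul_ne_zero (inv_ne_zero (by exact_mod_cast Nat.succ_ne_zero k)) (hQ z hz)
  have hP1 := hPu.derivative (by omega)
  have hP2 := hP1.derivative (by omega)
  have hhd' : (h.map (algebraMap ℝ ℂ)).natDegree = n := by rw [natDegree_map, hhd]
  refine ⟨m1, d1, m2, d2, m3, d3, ?_, ?_, ?_⟩
  · intro α β z hα hβ hz
    have key := boxplusEval_ne_zero (α ::ₘ β ::ₘ s) (x := z) hPu
      (by simp [hsc, hPd]) (by
        simp only [Multiset.mem_cons, forall_eq_or_imp]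
        exact ⟨by linarith, by linarith, him hz⟩)
    simp only [Multiset.map_cons, Multiset.prod_cons, Multiset.card_cons, hsc, ← hh'] at key
    convert key using 1
    simp only [aeval_boxplus, Polynomial.map_mul, map_X]
    have : (X - C α) * ((X - C β) * h.map (algebraMap ℝ ℂ)) =
        X * (X * h.map (algebraMap ℝ ℂ)) + C (-(α + β)) * (X * h.map (algebraMap ℝ ℂ)) +
          C (α * β) * h.map (algebraMap ℝ ℂ) := by
      simp only [C_neg, C_add, C_mul]
      ring
    rw [this, boxplusEval_add, boxplusEval_add, boxplusEval_C_mul, boxplusEval_C_mul]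
    ring
  · intro α z hα hz
    have key := boxplusEval_ne_zero (α ::ₘ s) (x := z) (hscale (k := n + 1) hP1)
      ((natDegree_C_mul_le _ _).trans (by simp [hsc, hPd1])) (by
        simp only [Multiset.mem_cons, forall_eq_or_imp]
        exact ⟨by linarith, him hz⟩)
    simp only [Multiset.map_cons, Multiset.prod_cons, Multiset.card_cons, hsc, ← hh'] at key
    have hdeg : ((X - C α) * h.map (algebraMap ℝ ℂ)).natDegree ≤ n + 1 := by
      refine natDegree_mul_le.trans ?_
      rw [natDegree_X_sub_C, hhd']
      omega
    rw [← boxplusEval_succ_of_natDegree_le _ hdeg] at key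
    convert key using 1
    simp only [aeval_boxplus, Polynomial.map_mul, map_X]
    have : (X - C α) * h.map (algebraMap ℝ ℂ) =
        X * h.map (algebraMap ℝ ℂ) + C (-α) * h.map (algebraMap ℝ ℂ) := by
      simp only [C_neg]
      ring
    rw [this, boxplusEval_add, boxplusEval_C_mul]
    ring
  · intro z hz
    have hc : derivative (C (((n + 1 : ℕ) : ℂ) + 1)⁻¹ * derivative P) =
        C (((n + 1 : ℕ) : ℂ) + 1)⁻¹ * P.derivative.derivative := derivative_C_mul _ _
    have key := boxplusEval_ne_zero s (x := z) (hscale (k := n) (hscale (k := n + 1) hP2))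
      ((natDegree_C_mul_le _ _).trans ((natDegree_C_mul_le _ _).trans (by simp [hsc, hPd2])))
      (him hz)
    rw [← hh', hsc, ← hc, ← boxplusEval_succ_of_natDegree_le _ hhd'.le,
      ← boxplusEval_succ_of_natDegree_le _ (by omega)] at key
    rwa [aeval_boxplus]

/-- The operator sending `P` to `P` minus `ε` times its derivative. -/
noncomputable def shiftDeriv (ε : ℝ) (P : ℝ[X]) : ℝ[X] := P - C ε * derivative P

theorem shiftDeriv_monic_natDegree (ε : ℝ) {P : ℝ[X]} (hP : P.Monic) :
    (shiftDeriv ε P).Monic ∧ (shiftDeriv ε P).natDegree = P.natDegree := by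
  by_cases h0 : P.natDegree = 0
  · have : P = 1 := hP.natDegree_eq_zero.mp h0
    subst this
    simp [shiftDeriv]
  · have hlt : (C ε * derivative P).natDegree < P.natDegree :=
      (natDegree_C_mul_le _ _).trans_lt (natDegree_derivative_lt h0)
    exact ⟨hP.sub_of_left (degree_lt_degree hlt), natDegree_sub_eq_left_of_natDegree_lt hlt⟩

theorem StableTriple.shiftDeriv {n : ℕ} {F N G : ℝ[X]} (h : StableTriple n F N G) (ε : ℝ) :
    StableTriple n (shiftDeriv ε F) (shiftDeriv ε N) (shiftDeriv ε G) := by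
  obtain ⟨m1, d1⟩ := shiftDeriv_monic_natDegree ε h.monic_fst
  obtain ⟨m2, d2⟩ := shiftDeriv_monic_natDegree ε h.monic_snd
  obtain ⟨m3, d3⟩ := shiftDeriv_monic_natDegree ε h.monic_trd
  refine ⟨m1, d1.trans h.natDegree_fst, m2, d2.trans h.natDegree_snd, m3,
    d3.trans h.natDegree_trd, ?_, ?_, ?_⟩
  · intro α β z hα hβ hz
    have hu : UpperFree (F.map (algebraMap ℝ ℂ) - C (α + β) * N.map (algebraMap ℝ ℂ) +
        C (α * β) * G.map (algebraMap ℝ ℂ)) := fun w hw => by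
      simpa [eval_map_algebraMap] using h.ne_zero_fst α β w hα hβ hw
    convert hu.sub_C_mul_derivative ε z hz using 1
    simp [_root_.shiftDeriv, ← eval_map_algebraMap, ← derivative_map]
    ring
  · intro α z hα hz
    have hu : UpperFree (N.map (algebraMap ℝ ℂ) - C α * G.map (algebraMap ℝ ℂ)) := fun w hw => by
      simpa [eval_map_algebraMap] using h.ne_zero_snd α w hα hw
    convert hu.sub_C_mul_derivative ε z hz using 1
    simp [_root_.shiftDeriv, ← eval_map_algebraMap, ← derivative_map]
    ring
  · intro z hz
    have hu : UpperFree (G.map (algebraMap ℝ ℂ)) := upperFree_map_iff.mpr h.ne_zero_trd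
    convert hu.sub_C_mul_derivative ε z hz using 1
    simp [_root_.shiftDeriv, ← eval_map_algebraMap, ← derivative_map]

theorem shiftDeriv_pencil (ε : ℝ) (F N G : ℝ[X]) (α β : ℝ) :
    shiftDeriv ε (pencil F N G α β) =
      pencil (shiftDeriv ε F) (shiftDeriv ε N) (shiftDeriv ε G) α β := by
  simp only [shiftDeriv, pencil, derivative_add, derivative_sub, derivative_C_mul]
  ring

/-! ### Nonnegative real polynomials are hermitian squares -/

theorem eval_nonneg_of_mul_sq {E : ℝ[X]} {a : ℝ} (h : ∀ x, 0 ≤ (x - a) ^ 2 * E.eval x) (x : ℝ) :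
    0 ≤ E.eval x := by
  have hc : IsClosed {x : ℝ | 0 ≤ E.eval x} := isClosed_le continuous_const E.continuous
  have hsub : ({a}ᶜ : Set ℝ) ⊆ {x : ℝ | 0 ≤ E.eval x} := fun y hy =>
    nonneg_of_mul_nonneg_right (h y) (by
      have : y - a ≠ 0 := sub_ne_zero.mpr hy
      positivity)
  exact closure_minimal hsub hc (dense_compl_singleton a x)

theorem exists_hermitian_square_of_nonneg {D : ℝ[X]} (hD : ∀ x, 0 ≤ D.eval x) :
    ∃ R : ℂ[X], D.map (algebraMap ℝ ℂ) = R * R.map (starRingEnd ℂ) := by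
  induction hn : D.natDegree using Nat.strong_induction_on generalizing D with
  | _ n ih =>
  by_cases h0 : D.natDegree = 0
  · rw [natDegree_eq_zero] at h0
    obtain ⟨d, rfl⟩ := h0
    have hd : 0 ≤ d := by simpa using hD 0
    refine ⟨C ((√d : ℝ) : ℂ), ?_⟩
    rw [Polynomial.map_C, Polynomial.map_C, ← C_mul, Complex.conj_ofReal, ← Complex.ofReal_mul,
      Real.mul_self_sqrt hd]
    rfl
  · have hdeg : D.degree ≠ 0 := fun h => h0 (natDegree_eq_of_degree_eq_some h)
    have hD0 : D ≠ 0 := by rintro rfl; simp at h0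
    obtain ⟨z, hz⟩ := IsAlgClosed.exists_aeval_eq_zero ℂ D hdeg
    by_cases him : z.im = 0
    · have hz' : z = algebraMap ℝ ℂ z.re := Complex.ext (by simp) (by simp [him])
      rw [hz', aeval_algebraMap_apply, coe_aeval_eq_eval] at hz
      set a := z.re
      have ha : D.eval a = 0 := by simpa using hz
      have hmin : IsLocalMin (fun x => D.eval x) a :=
        Filter.Eventually.of_forall fun x => by simpa [ha] using hD x
      have hder : D.derivative.eval a = 0 := by
        simpa using hmin.deriv_eq_zero
      obtain ⟨E, rfl⟩ := dvd_iff_isRoot.mpr ha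
      have hEa : E.IsRoot a := by simpa [derivative_mul] using hder
      obtain ⟨E, rfl⟩ := dvd_iff_isRoot.mpr hEa
      have hE0 : E ≠ 0 := by rintro rfl; simp at hD0
      have hE : ∀ x, 0 ≤ E.eval x := eval_nonneg_of_mul_sq (a := a) fun x => by
        have := hD x
        simp only [eval_mul, eval_sub, eval_X, eval_C] at this
        linarith
      obtain ⟨R, hR⟩ := ih E.natDegree (by
        rw [natDegree_mul (X_sub_C_ne_zero a) (mul_ne_zero (X_sub_C_ne_zero a) hE0),
          natDegree_mul (X_sub_C_ne_zero a) hE0, natDegree_X_sub_C] at hn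
        omega) hE rfl
      refine ⟨(X - C (a : ℂ)) * R, ?_⟩
      simp only [Polynomial.map_mul, hR, Polynomial.map_sub, map_X, Polynomial.map_C,
        Complex.conj_ofReal, Complex.coe_algebraMap]
      ring
    · obtain ⟨E, rfl⟩ := quadratic_dvd_of_aeval_eq_zero_im_ne_zero D hz him
      have hE0 : E ≠ 0 := by rintro rfl; simp at hD0
      have hns : ‖z‖ ^ 2 = z.re ^ 2 + z.im ^ 2 := by
        rw [← Complex.normSq_eq_norm_sq, Complex.normSq_apply]
        ring
      have hE : ∀ x, 0 ≤ E.eval x := fun x => by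
        refine nonneg_of_mul_nonneg_right (a := (x - z.re) ^ 2 + z.im ^ 2) ?_ 
          (add_pos_of_nonneg_of_pos (sq_nonneg _) (sq_pos_of_ne_zero him))
        have := hD x
        simp only [eval_mul, eval_sub, eval_add, eval_pow, eval_X, eval_C, hns] at this
        linarith
      have hq : (X ^ 2 - C (2 * z.re) * X + C (‖z‖ ^ 2) : ℝ[X]).natDegree = 2 := by
        compute_degree!
      obtain ⟨R, hR⟩ := ih E.natDegree (by
        rw [natDegree_mul (left_ne_zero_of_mul hD0) hE0, hq] at hn
        omega) hE rfl
      refine ⟨(X - C z) * R, ?_⟩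
      have e1 : ((2 * z.re : ℝ) : ℂ) = z + starRingEnd ℂ z := by
        rw [Complex.add_conj]
      have e2 : ((‖z‖ ^ 2 : ℝ) : ℂ) = z * starRingEnd ℂ z := by
        rw [Complex.mul_conj, Complex.normSq_eq_norm_sq]
      simp only [Polynomial.map_mul, hR, Polynomial.map_sub, Polynomial.map_add, Polynomial.map_pow,
        map_X, Polynomial.map_C, Complex.coe_algebraMap]
      rw [e1, e2, C_add, C_mul]
      ring

/-! ### Inequalities for stable triples -/

section

open Filter Topology

theorem tendsto_add_mul_I (x : ℝ) :
    Tendsto (fun ε : ℝ => (x : ℂ) + ε * Complex.I) (𝓝[>] 0) (𝓝 (x : ℂ)) := by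
  have : Continuous fun ε : ℝ => (x : ℂ) + ε * Complex.I := by fun_prop
  simpa using (this.tendsto 0).mono_left nhdsWithin_le_nhds

theorem aeval_ofReal (P : ℝ[X]) (x : ℝ) : aeval (x : ℂ) P = ((P.eval x : ℝ) : ℂ) := by
  simpa using aeval_algebraMap_apply ℂ x P

theorem tendsto_aeval_add_mul_I (P : ℝ[X]) (x : ℝ) :
    Tendsto (fun ε : ℝ => aeval ((x : ℂ) + ε * Complex.I) P) (𝓝[>] 0) (𝓝 ((P.eval x : ℝ) : ℂ)) := by
  rw [← aeval_ofReal]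
  exact ((Polynomial.continuous_aeval P).tendsto _).comp (tendsto_add_mul_I x)

theorem StableTriple.mul_le_sq {n : ℕ} {F N G : ℝ[X]} (h : StableTriple n F N G) (x : ℝ) :
    F.eval x * G.eval x ≤ N.eval x ^ 2 := by
  by_contra! hlt
  have hg : G.eval x ≠ 0 := by
    intro h0
    rw [h0, mul_zero] at hlt
    exact absurd hlt (not_lt.mpr (sq_nonneg _))
  have hpos : 0 < F.eval x * G.eval x - N.eval x ^ 2 := sub_pos.mpr hlt
  set w := √(F.eval x * G.eval x - N.eval x ^ 2) / |G.eval x| with hw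
  have hwpos : 0 < w := div_pos (Real.sqrt_pos.mpr hpos) (abs_pos.mpr hg)
  have hwsq : w ^ 2 * G.eval x ^ 2 = F.eval x * G.eval x - N.eval x ^ 2 := by
    rw [hw, div_pow, Real.sq_sqrt hpos.le, sq_abs]
    field_simp
  set a : ℂ := ⟨N.eval x / G.eval x, -w⟩ with ha
  have hquad : ((F.eval x : ℝ) : ℂ) - a * N.eval x = a * (N.eval x - a * G.eval x) := by
    apply Complex.ext
    · simp [ha]
      field_simp
      nlinarith
    · simp [ha]
      field_simp
      ring
  have hden : ((N.eval x : ℝ) : ℂ) - a * G.eval x ≠ 0 := by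
    intro h0
    have := congrArg Complex.im h0
    simp [ha, hg, hwpos.ne'] at this
  have haim : a.im ≤ 0 := by simp [ha, hwpos.le]
  have hlim : Tendsto (fun ε : ℝ =>
      ((aeval ((x : ℂ) + ε * Complex.I) F - a * aeval ((x : ℂ) + ε * Complex.I) N) /
        (aeval ((x : ℂ) + ε * Complex.I) N - a * aeval ((x : ℂ) + ε * Complex.I) G)).im)
      (𝓝[>] 0) (𝓝 a.im) := by
    refine (Complex.continuous_im.tendsto a).comp ?_
    have := ((tendsto_aeval_add_mul_I F x).sub ((tendsto_aeval_add_mul_I N x).const_mul a)).div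
      ((tendsto_aeval_add_mul_I N x).sub ((tendsto_aeval_add_mul_I G x).const_mul a)) hden
    rwa [hquad, mul_div_cancel_right₀ _ hden] at this
  have hev := hlim.eventually (gt_mem_nhds (show a.im < 0 by simp [ha, hwpos]))
  obtain ⟨ε, hε, hε0⟩ := (hev.and self_mem_nhdsWithin).exists
  set z := (x : ℂ) + ε * Complex.I with hz
  have hzim : 0 < z.im := by simpa [hz] using hε0
  have hd := h.ne_zero_snd a z haim hzim
  refine h.ne_zero_fst _ a z hε.le haim hzim ?_
  field_simp
  ring

theorem StableTriple.eval_div_nonpos {n : ℕ} {F N G K : ℝ[X]} (h : StableTriple n F N G) {γ : ℝ}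
    (hG : G = (X - C γ) * K) (hK : K.eval γ ≠ 0) : N.eval γ / K.eval γ ≤ 0 := by
  have hlim : Tendsto (fun ε : ℝ =>
      (aeval ((γ : ℂ) + ε * Complex.I) N / aeval ((γ : ℂ) + ε * Complex.I) K).re)
      (𝓝[>] 0) (𝓝 (N.eval γ / K.eval γ)) := by
    have := (Complex.continuous_re.tendsto _).comp
      ((tendsto_aeval_add_mul_I N γ).div (tendsto_aeval_add_mul_I K γ) (by exact_mod_cast hK))
    rwa [← Complex.ofReal_div, Complex.ofReal_re] at this
  refine le_of_tendsto hlim ?_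
  filter_upwards [self_mem_nhdsWithin] with ε hε
  have hε' : (0 : ℝ) < ε := hε
  set z := (γ : ℂ) + ε * Complex.I with hz
  have hzim : 0 < z.im := by simpa [hz] using hε'
  have hGz : aeval z G = ε * Complex.I * aeval z K := by
    rw [hG, hz]
    simp
  have hGne := h.ne_zero_trd z hzim
  by_contra! hpos
  refine h.ne_zero_snd (aeval z N / aeval z G) z ?_ hzim (by field_simp; ring)
  have hKne : aeval z K ≠ 0 := by
    intro h0
    exact hGne (by rw [hGz, h0, mul_zero])
  have : aeval z N / aeval z G = ((ε⁻¹ : ℝ) : ℂ) * (-Complex.I * (aeval z N / aeval z K)) := by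
    rw [hGz]
    have : (ε : ℂ) ≠ 0 := by exact_mod_cast hε'.ne'
    push_cast
    field_simp
    rw [Complex.I_sq]
    ring
  rw [this, Complex.im_ofReal_mul]
  have hi : 0 < ε⁻¹ := inv_pos.mpr hε'
  simp only [neg_mul, Complex.neg_im, Complex.I_mul_im]
  nlinarith

end

/-! ### Hermitian determinantal representation -/

theorem eval_eq_nodal_mul {K ι : Type*} [Field K] [Fintype ι] [DecidableEq ι] {v : ι → K}
    (hv : Function.Injective v) {P : K[X]} (hP : P.natDegree ≤ Fintype.card ι) {x : K}
    (hx : ∀ i, x ≠ v i) :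
    P.eval x = (Lagrange.nodal Finset.univ v).eval x * (P.coeff (Fintype.card ι) +
      ∑ i, Lagrange.nodalWeight Finset.univ v i * (x - v i)⁻¹ * P.eval (v i)) := by
  set c := P.coeff (Fintype.card ι)
  set G := Lagrange.nodal Finset.univ v with hG
  have hdG : G.natDegree = Fintype.card ι := by rw [hG, Lagrange.natDegree_nodal, Finset.card_univ]
  have hmG : G.Monic := Lagrange.nodal_monic
  have hcG : G.coeff (Fintype.card ι) = 1 := by rw [← hdG]; exact hmG
  have hdeg : (P - C c * G).degree < (Finset.univ : Finset ι).card := by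
    rw [Finset.card_univ, degree_lt_iff_coeff_zero]
    intro k hk
    rcases hk.eq_or_lt with rfl | hk
    · rw [coeff_sub, coeff_C_mul, hcG, mul_one, sub_self]
    · rw [coeff_sub, coeff_C_mul, coeff_eq_zero_of_natDegree_lt (hP.trans_lt hk),
        coeff_eq_zero_of_natDegree_lt (hdG.trans_lt hk), mul_zero, sub_zero]
  have hi := congrArg (eval x) (Lagrange.eq_interpolate hv.injOn hdeg)
  rw [Lagrange.eval_interpolate_not_at_node _ fun i _ => hx i] at hi
  simp only [eval_sub, eval_mul, eval_C, ← hG] at hi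
  have h0 : ∀ i, G.eval (v i) = 0 := fun i => Lagrange.eval_nodal_at_node (Finset.mem_univ i)
  simp only [h0, mul_zero, sub_zero] at hi
  rw [mul_add, ← hi]
  ring

open Matrix in
theorem eval_charpoly_fromBlocks_diagonal {ι : Type*} [Fintype ι] [DecidableEq ι]
    (A : Matrix (Fin 2) (Fin 2) ℂ)
    (B : Matrix (Fin 2) ι ℂ) (γ : ι → ℂ) {x : ℂ} (hx : ∀ j, x ≠ γ j) :
    (fromBlocks A B Bᴴ (diagonal γ)).charpoly.eval x = (∏ j, (x - γ j)) *
      ((x - A 0 0 - ∑ j, B 0 j * (x - γ j)⁻¹ * star (B 0 j)) *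
        (x - A 1 1 - ∑ j, B 1 j * (x - γ j)⁻¹ * star (B 1 j)) -
        (A 0 1 + ∑ j, B 0 j * (x - γ j)⁻¹ * star (B 1 j)) *
          (A 1 0 + ∑ j, B 1 j * (x - γ j)⁻¹ * star (B 0 j))) := by
  have hne : ∀ j, x - γ j ≠ 0 := fun j => sub_ne_zero.mpr (hx j)
  have hblock : scalar (Fin 2 ⊕ ι) x - fromBlocks A B Bᴴ (diagonal γ) =
      fromBlocks (scalar (Fin 2) x - A) (-B) (-Bᴴ) (diagonal fun j => x - γ j) := by
    ext (i | i) (j | j)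
    · simp [Matrix.diagonal_apply]
    · simp
    · simp
    · by_cases hij : i = j <;> simp [hij]
  have hinv : diagonal (fun j => x - γ j) * diagonal (fun j => (x - γ j)⁻¹) = 1 := by
    rw [diagonal_mul_diagonal, ← diagonal_one]
    congr 1
    funext j
    exact mul_inv_cancel₀ (hne j)
  let _ := invertibleOfRightInverse _ _ hinv
  have hinvOf : ⅟(diagonal fun j => x - γ j) = diagonal fun j => (x - γ j)⁻¹ :=
    invOf_eq_right_inv hinv
  rw [eval_charpoly, hblock, det_fromBlocks₂₂, det_diagonal, hinvOf, det_fin_two]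
  simp only [Matrix.sub_apply, mul_apply (M := _ * _), mul_diagonal, Matrix.neg_apply,
    conjTranspose_apply, scalar_apply,
    diagonal_apply_eq, ne_eq, zero_ne_one, one_ne_zero, not_false_eq_true, diagonal_apply_ne,
    neg_mul, mul_neg, neg_neg]
  ring

open Matrix in
theorem StableTriple.exists_isHermitian {n : ℕ} {F N G : ℝ[X]} (h : StableTriple n F N G)
    {ι : Type*} [Fintype ι] [DecidableEq ι] {γ : ι → ℝ} (hγ : Function.Injective γ)
    (hG : G = Lagrange.nodal Finset.univ γ) :
    ∃ M : Matrix (Fin 2 ⊕ ι) (Fin 2 ⊕ ι) ℂ, M.IsHermitian ∧ ∀ α β : ℝ,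
      (M + diagonal (Sum.elim ![(α : ℂ), (β : ℂ)] 0)).charpoly =
        (pencil F N G α β).map (algebraMap ℝ ℂ) := by
  have hn : Fintype.card ι = n := by
    rw [← h.natDegree_trd, hG, Lagrange.natDegree_nodal, Finset.card_univ]
  obtain ⟨R, hR⟩ := exists_hermitian_square_of_nonneg (D := N ^ 2 - F * G) fun x => by
    simpa using h.mul_le_sq x
  have hRd : R.natDegree ≤ n := by
    have h1 : (N ^ 2 - F * G).natDegree < 2 * n + 2 := by
      have hd1 : (N ^ 2).natDegree = 2 * n + 2 := by
        rw [h.monic_snd.natDegree_pow, h.natDegree_snd]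
        ring
      have hd2 : (F * G).natDegree = 2 * n + 2 := by
        rw [h.monic_fst.natDegree_mul h.monic_trd, h.natDegree_fst, h.natDegree_trd]
        ring
      rcases eq_or_ne (N ^ 2 - F * G) 0 with h0 | h0
      · rw [h0, natDegree_zero]
        omega
      · rw [← hd1]
        refine natDegree_lt_natDegree h0 (degree_sub_lt_left ?_ (h.monic_snd.pow 2).ne_zero ?_)
        · rw [degree_eq_natDegree (h.monic_snd.pow 2).ne_zero,
            degree_eq_natDegree (h.monic_fst.mul h.monic_trd).ne_zero, hd1, hd2]
        · rw [(h.monic_snd.pow 2).leadingCoeff, (h.monic_fst.mul h.monic_trd).leadingCoeff]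
    have h2 : (R * R.map (starRingEnd ℂ)).natDegree = R.natDegree + R.natDegree := by
      rcases eq_or_ne R 0 with rfl | h0
      · simp
      · rw [natDegree_mul h0 ((Polynomial.map_ne_zero_iff (starRingEnd ℂ).injective).mpr h0),
          natDegree_map]
    rw [← hR, natDegree_map] at h2
    omega
  set w : ι → ℝ := Lagrange.nodalWeight Finset.univ γ with hw
  set v : ι → ℂ := fun j => (γ j : ℂ) with hv
  have hvinj : Function.Injective v := Complex.ofReal_injective.comp hγ
  have hwv : ∀ j, Lagrange.nodalWeight Finset.univ v j = w j := fun j => by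
    simp [hw, hv, Lagrange.nodalWeight]
  set m : ι → ℝ := fun j => -(w j * N.eval (γ j)) with hm
  have hm0 : ∀ j, 0 ≤ m j := fun j => by
    have hfac := Lagrange.nodal_eq_mul_nodal_erase (v := γ) (Finset.mem_univ j)
    rw [← hG] at hfac
    have hne : (Lagrange.nodal (Finset.univ.erase j) γ).eval (γ j) ≠ 0 :=
      Lagrange.eval_nodal_not_at_node fun i hi => hγ.ne (Finset.ne_of_mem_erase hi).symm
    have := h.eval_div_nonpos hfac hne
    rw [hm, hw]
    simp only
    rw [Lagrange.nodalWeight_eq_eval_nodal_erase_inv, ← div_eq_inv_mul]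
    linarith
  set r : ι → ℂ := fun j => w j * R.eval (v j) with hr
  have hGv : ∀ j, G.eval (γ j) = 0 := fun j => by
    rw [hG]
    exact Lagrange.eval_nodal_at_node (Finset.mem_univ j)
  have hconj : ∀ x : ℝ, (R.map (starRingEnd ℂ)).eval (x : ℂ) = star (R.eval (x : ℂ)) := fun x => by
    rw [← Complex.conj_ofReal x, eval_map_apply, Complex.conj_ofReal]
    rfl
  have hRx : ∀ x : ℝ, R.eval (x : ℂ) * star (R.eval (x : ℂ)) =
      ((N.eval x ^ 2 - F.eval x * G.eval x : ℝ) : ℂ) := fun x => by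
    have := congrArg (eval (x : ℂ)) hR
    rw [eval_mul, hconj, eval_map_algebraMap, aeval_ofReal] at this
    rw [← this]
    simp
  have hrr : ∀ j, r j * star (r j) = ((m j ^ 2 : ℝ) : ℂ) := fun j => by
    have := hRx (γ j)
    rw [hGv, mul_zero, sub_zero] at this
    simp only [hr, hm, star_mul', neg_sq, mul_pow]
    rw [mul_mul_mul_comm, this, show star (w j : ℂ) = w j from Complex.conj_ofReal _]
    push_cast
    ring
  set b₀ : ι → ℂ := fun j => (√(m j) : ℝ) with hb₀
  set b₁ : ι → ℂ := fun j => -star (r j) / (√(m j) : ℝ) with hb₁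
  have hsq : ∀ j, ((√(m j) : ℝ) : ℂ) * (√(m j) : ℝ) = m j := fun j => by
    rw [← Complex.ofReal_mul, Real.mul_self_sqrt (hm0 j)]
  have hstar : ∀ j, star ((√(m j) : ℝ) : ℂ) = (√(m j) : ℝ) := fun j => Complex.conj_ofReal _
  have hrm : ∀ j, √(m j) = 0 → r j = 0 ∧ m j = 0 := fun j h0 => by
    have hmj : m j = 0 := (Real.sqrt_eq_zero (hm0 j)).mp h0
    refine ⟨?_, hmj⟩
    have := hrr j
    rw [hmj] at this
    simpa using this
  have hb₀₀ : ∀ j, b₀ j * star (b₀ j) = m j := fun j => by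
    simp only [hb₀]
    rw [hstar, hsq]
  have hb₀₁ : ∀ j, b₀ j * star (b₁ j) = -r j := fun j => by
    simp only [hb₀, hb₁, star_div₀, star_neg, star_star, hstar]
    by_cases h0 : √(m j) = 0
    · simp [(hrm j h0).1]
    · have : ((√(m j) : ℝ) : ℂ) ≠ 0 := by exact_mod_cast h0
      field_simp
  have hb₁₀ : ∀ j, b₁ j * star (b₀ j) = -star (r j) := fun j => by
    rw [← star_neg, ← hb₀₁, star_mul', star_star, mul_comm]
  have hb₁₁ : ∀ j, b₁ j * star (b₁ j) = m j := fun j => by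
    simp only [hb₁, star_div₀, star_neg, star_star, hstar]
    by_cases h0 : √(m j) = 0
    · simp [(hrm j h0).1, (hrm j h0).2]
    · have hm1 : (m j : ℂ) ≠ 0 := by
        rw [← hsq]
        exact_mod_cast mul_ne_zero h0 h0
      rw [div_mul_div_comm, hsq, neg_mul_neg, mul_comm, hrr, div_eq_iff hm1]
      push_cast
      ring
  set c : ℝ := (N - X * G).coeff n with hc
  set ρ : ℂ := R.coeff n with hρ
  have hNd : (N - X * G).natDegree ≤ n := by
    have hd : (X * G).natDegree = n + 1 := by rw [natDegree_X_mul h.monic_trd.ne_zero,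
      h.natDegree_trd]
    refine natDegree_le_iff_coeff_eq_zero.mpr fun k hk => ?_
    rcases Nat.lt_or_eq_of_le (Nat.succ_le_of_lt hk) with hk | rfl
    · rw [coeff_sub, coeff_eq_zero_of_natDegree_lt (h.natDegree_snd.trans_lt hk),
        coeff_eq_zero_of_natDegree_lt (hd.trans_lt hk), sub_zero]
    · have h1 := h.monic_snd.coeff_natDegree
      have h2 := (monic_X.mul h.monic_trd).coeff_natDegree
      rw [h.natDegree_snd] at h1
      rw [hd] at h2
      rw [coeff_sub, Nat.succ_eq_add_one, h1, h2, sub_self]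
  set B : Matrix (Fin 2) ι ℂ := of ![b₀, b₁] with hB
  refine ⟨fromBlocks !![-(c : ℂ), -ρ; -star ρ, -(c : ℂ)] B Bᴴ (diagonal v), ?_, ?_⟩
  · refine IsHermitian.fromBlocks ?_ rfl ?_
    · ext i j
      fin_cases i <;> fin_cases j <;> simp
    · refine isHermitian_diagonal_iff.mpr fun j => ?_
      exact Complex.conj_ofReal _
  · intro α β
    have hsum : fromBlocks !![-(c : ℂ), -ρ; -star ρ, -(c : ℂ)] B Bᴴ (diagonal v) +
        diagonal (Sum.elim ![(α : ℂ), (β : ℂ)] 0) =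
        fromBlocks !![α - (c : ℂ), -ρ; -star ρ, β - (c : ℂ)] B Bᴴ (diagonal v) := by
      ext (i | i) (j | j)
      · fin_cases i <;> fin_cases j <;> simp <;> ring
      · simp
      · simp
      · simp [diagonal_apply]
    rw [hsum]
    refine eq_of_infinite_eval_eq _ _ (Set.Infinite.mono (s := Complex.ofReal '' (Set.range γ)ᶜ)
      ?_ ((Set.finite_range γ).infinite_compl.image Complex.ofReal_injective.injOn))
    rintro _ ⟨x, hx, rfl⟩
    have hxγ : ∀ j, x ≠ γ j := fun j hj => hx ⟨j, hj.symm⟩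
    have hxv : ∀ j, (x : ℂ) ≠ v j := fun j hj => hxγ j (Complex.ofReal_injective hj)
    have hGx : ((G.eval x : ℝ) : ℂ) ≠ 0 := by
      rw [hG]
      exact_mod_cast Lagrange.eval_nodal_not_at_node fun i _ => hxγ i
    have hprod : ∏ j, ((x : ℂ) - v j) = (G.eval x : ℝ) := by
      rw [hG, Lagrange.eval_nodal]
      simp [hv]
    have hN : ((N.eval x : ℝ) : ℂ) = (G.eval x : ℝ) * (x + c - ∑ j, m j * ((x : ℂ) - v j)⁻¹) := by
      have := eval_eq_nodal_mul hγ (P := N - X * G) (by rwa [hn]) hxγ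
      rw [← hG, hn, ← hc] at this
      simp only [eval_sub, eval_mul, eval_X, hGv, mul_zero, sub_zero] at this
      have e : N.eval x = G.eval x * (x + c - ∑ j, m j * (x - γ j)⁻¹) := by
        have e' : ∑ j, m j * (x - γ j)⁻¹ =
            -∑ j, Lagrange.nodalWeight Finset.univ γ j * (x - γ j)⁻¹ * N.eval (γ j) := by
          rw [← Finset.sum_neg_distrib]
          exact Finset.sum_congr rfl fun j _ => by simp only [hm, hw]; ring
        rw [e']
        linear_combination this
      rw [e]
      simp [hv]
    have hRe : R.eval (x : ℂ) = (G.eval x : ℝ) * (ρ + ∑ j, r j * ((x : ℂ) - v j)⁻¹) := by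
      have := eval_eq_nodal_mul hvinj (P := R) (by rwa [hn]) hxv
      rw [this, Lagrange.eval_nodal, hprod, hn]
      congr 2
      exact Finset.sum_congr rfl fun j _ => by simp only [hwv, hr]; ring
    have hRs : star (R.eval (x : ℂ)) =
        (G.eval x : ℝ) * (star ρ + ∑ j, star (r j) * ((x : ℂ) - v j)⁻¹) := by
      rw [hRe]
      simp [hv]
    have hkey := hRx x
    rw [hRs, hRe] at hkey
    push_cast at hkey
    rw [Set.mem_ofPred_eq, eval_charpoly_fromBlocks_diagonal _ _ _ hxv, hprod, eval_map_algebraMap,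
      aeval_ofReal]
    simp only [hB, of_apply, cons_val_zero, cons_val_one, cons_val', cons_val_fin_one,
      mul_right_comm _ _ (star _), hb₀₀, hb₀₁, hb₁₀, hb₁₁, neg_mul, Finset.sum_neg_distrib, pencil,
      eval_add, eval_sub, eval_mul, eval_C]
    push_cast
    set S : ℂ := ∑ j, m j * ((x : ℂ) - v j)⁻¹
    refine mul_left_cancel₀ hGx ?_
    linear_combination -hkey + ((α + β) * (G.eval x : ℝ) - (N.eval x : ℝ) -
      (G.eval x : ℝ) * (x + c - S)) * hN

/-! ### Convex majorization -/

/-- `ConvMaj x y` says that `∑ φ(y_i) ≤ ∑ φ(x_i)` for every convex function `φ` on the line. -/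
def ConvMaj (x y : Multiset ℝ) : Prop :=
  ∀ φ : ℝ → ℝ, ConvexOn ℝ Set.univ φ → (y.map φ).sum ≤ (x.map φ).sum

theorem ConvMaj.refl (x : Multiset ℝ) : ConvMaj x x := fun _ _ => le_rfl

theorem ConvMaj.trans {x y z : Multiset ℝ} (hxy : ConvMaj x y) (hyz : ConvMaj y z) : ConvMaj x z :=
  fun φ hφ => (hyz φ hφ).trans (hxy φ hφ)

open Matrix in
theorem sum_normSq_row {ι : Type*} [Fintype ι] [DecidableEq ι] {W : Matrix ι ι ℂ}
    (hW : W ∈ unitaryGroup ι ℂ) (i : ι) : ∑ j, Complex.normSq (W i j) = 1 := by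
  have h := congrFun (congrFun (mem_unitaryGroup_iff.mp hW) i) i
  rw [mul_apply, one_apply_eq] at h
  have : ((∑ j, Complex.normSq (W i j) : ℝ) : ℂ) = 1 := by
    rw [← h]
    push_cast
    exact Finset.sum_congr rfl fun j _ => (Complex.mul_conj _).symm
  exact_mod_cast this

open Matrix in
theorem sum_normSq_col {ι : Type*} [Fintype ι] [DecidableEq ι] {W : Matrix ι ι ℂ}
    (hW : W ∈ unitaryGroup ι ℂ) (j : ι) : ∑ i, Complex.normSq (W i j) = 1 := by
  have := sum_normSq_row (W := star W) (Unitary.star_mem hW) j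
  simpa [star_apply] using this

open Matrix in
/-- The diagonal of a hermitian matrix in any orthonormal basis is dominated by its spectrum. -/
theorem sum_convex_diag_le {ι : Type*} [Fintype ι] [DecidableEq ι] {A U : Matrix ι ι ℂ}
    (hA : A.IsHermitian) (hU : U ∈ unitaryGroup ι ℂ) {φ : ℝ → ℝ} (hφ : ConvexOn ℝ Set.univ φ) :
    ∑ i, φ ((star U * A * U) i i).re ≤ ∑ j, φ (hA.eigenvalues j) := by
  set V : Matrix ι ι ℂ := hA.eigenvectorUnitary.1
  set W := star U * V with hWdef
  have hW : W ∈ unitaryGroup ι ℂ := mul_mem (Unitary.star_mem hU) hA.eigenvectorUnitary.2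
  have hAW : star U * A * U = W * diagonal (RCLike.ofReal ∘ hA.eigenvalues) * star W := by
    conv_lhs => rw [hA.spectral_theorem, Unitary.conjStarAlgAut_apply]
    simp only [hWdef, star_mul, star_star, Matrix.mul_assoc]
    rfl
  have hdiag : ∀ i, ((star U * A * U) i i).re =
      ∑ j, Complex.normSq (W i j) • hA.eigenvalues j := fun i => by
    rw [hAW, mul_apply, Complex.re_sum]
    refine Finset.sum_congr rfl fun j _ => ?_
    rw [mul_diagonal, star_apply, mul_right_comm, show W i j * star (W i j) = _ from
      Complex.mul_conj _]
    simp
  calc ∑ i, φ ((star U * A * U) i i).re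
      ≤ ∑ i, ∑ j, Complex.normSq (W i j) • φ (hA.eigenvalues j) := by
        refine Finset.sum_le_sum fun i _ => ?_
        rw [hdiag]
        exact hφ.map_sum_le (fun j _ => Complex.normSq_nonneg _) (sum_normSq_row hW i)
          fun _ _ => Set.mem_univ _
    _ = ∑ j, φ (hA.eigenvalues j) := by
        rw [Finset.sum_comm]
        refine Finset.sum_congr rfl fun j _ => ?_
        rw [← Finset.sum_smul, sum_normSq_col hW, one_smul]

open Matrix in
/-- **Peierls inequality**: convexity of `A ↦ tr φ(A)` on hermitian matrices. -/
theorem sum_convex_eigenvalues_le {ι : Type*} [Fintype ι] [DecidableEq ι] {A B M : Matrix ι ι ℂ}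
    (hA : A.IsHermitian) (hB : B.IsHermitian) (hM : M.IsHermitian) {a b : ℝ} (ha : 0 ≤ a)
    (hb : 0 ≤ b) (hab : a + b = 1) (h : M = a • A + b • B) {φ : ℝ → ℝ}
    (hφ : ConvexOn ℝ Set.univ φ) :
    ∑ i, φ (hM.eigenvalues i) ≤
      a * ∑ i, φ (hA.eigenvalues i) + b * ∑ i, φ (hB.eigenvalues i) := by
  set U : Matrix ι ι ℂ := hM.eigenvectorUnitary.1 with hU
  have hUm : U ∈ unitaryGroup ι ℂ := hM.eigenvectorUnitary.2
  have hdiag : ∀ i, hM.eigenvalues i =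
      a • ((star U * A * U) i i).re + b • ((star U * B * U) i i).re := fun i => by
    have h1 := hM.conjStarAlgAut_star_eigenvectorUnitary
    rw [Unitary.conjStarAlgAut_star_apply, ← hU] at h1
    have h2 := congrArg Complex.re (congrFun (congrFun h1 i) i)
    have h3 : star U * M * U = a • (star U * A * U) + b • (star U * B * U) := by
      rw [h, Matrix.mul_add, Matrix.add_mul]
      simp only [Matrix.mul_smul, Matrix.smul_mul]
    rw [h3] at h2
    simpa using h2.symm
  calc ∑ i, φ (hM.eigenvalues i)
      ≤ ∑ i, (a * φ ((star U * A * U) i i).re + b * φ ((star U * B * U) i i).re) := by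
        refine Finset.sum_le_sum fun i _ => ?_
        rw [hdiag]
        exact hφ.2 (Set.mem_univ _) (Set.mem_univ _) ha hb hab
    _ = a * ∑ i, φ ((star U * A * U) i i).re + b * ∑ i, φ ((star U * B * U) i i).re := by
        rw [Finset.sum_add_distrib, Finset.mul_sum, Finset.mul_sum]
    _ ≤ _ := add_le_add
        (mul_le_mul_of_nonneg_left (sum_convex_diag_le hA hUm hφ) ha)
        (mul_le_mul_of_nonneg_left (sum_convex_diag_le hB hUm hφ) hb)

open Matrix in
theorem roots_eq_eigenvalues {ι : Type*} [Fintype ι] [DecidableEq ι] {A : Matrix ι ι ℂ}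
    (hA : A.IsHermitian) {P : ℝ[X]} (h : A.charpoly = P.map (algebraMap ℝ ℂ)) :
    P.roots = Finset.univ.val.map hA.eigenvalues := by
  have hP : P = ∏ i, (X - C (hA.eigenvalues i)) := by
    refine map_injective _ (algebraMap ℝ ℂ).injective ?_
    rw [← h, hA.charpoly_eq, Polynomial.map_prod]
    simp
  rw [hP, roots_prod _ _ (Finset.prod_ne_zero_iff.mpr fun i _ => X_sub_C_ne_zero _)]
  simp

theorem pencil_comm (F N G : ℝ[X]) (α β : ℝ) : pencil F N G α β = pencil F N G β α := by
  rw [pencil, pencil, add_comm α, mul_comm α]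

open Matrix in
theorem StableTriple.convMaj_of_nodup {n : ℕ} {F N G : ℝ[X]} (h : StableTriple n F N G)
    (hG : G.roots.Nodup) {a b : ℝ} (ha : 0 ≤ a) (hb : 0 ≤ b) (hab : a + b = 1) (α β : ℝ) :
    ConvMaj (pencil F N G α β).roots (pencil F N G (a * α + b * β) (a * β + b * α)).roots := by
  have hGc : Multiset.card G.roots = G.natDegree :=
    card_roots_of_upperFree (upperFree_map_iff.mpr h.ne_zero_trd)
  have hGn : G = Lagrange.nodal Finset.univ (Subtype.val : G.roots.toFinset → ℝ) := by
    rw [Lagrange.nodal_eq, Finset.prod_coe_sort G.roots.toFinset fun x => X - C x]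
    conv_lhs => rw [← eq_prod_of_card_roots h.monic_trd hGc]
    rw [Finset.prod, Multiset.toFinset_val, hG.dedup]
  obtain ⟨M, hM, hchar⟩ := h.exists_isHermitian Subtype.val_injective hGn
  have hD : ∀ x y : ℝ,
      (M + diagonal (Sum.elim ![(x : ℂ), (y : ℂ)] (0 : G.roots.toFinset → ℂ))).IsHermitian := by
    intro x y
    refine hM.add (isHermitian_diagonal_iff.mpr ?_)
    rintro (i | i)
    · fin_cases i <;> exact Complex.conj_ofReal _
    · exact star_zero _
  intro φ hφ
  have key := sum_convex_eigenvalues_le (hD α β) (hD β α) (hD (a * α + b * β) (a * β + b * α))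
    ha hb hab (by
      have hM1 : M = a • M + b • M := by rw [← add_smul, hab, one_smul]
      rw [smul_add, smul_add, add_add_add_comm, ← hM1]
      congr 1
      ext i j
      rcases i with i | i <;> rcases j with j | j
      · fin_cases i <;> fin_cases j <;> simp
      · simp
      · simp
      · simp [diagonal_apply]) hφ
  have e : ∀ x y : ℝ, ∑ i, φ ((hD x y).eigenvalues i) = ((pencil F N G x y).roots.map φ).sum := by
    intro x y
    rw [roots_eq_eigenvalues (hD x y) (hchar x y), Multiset.map_map]
    rfl
  rw [e, e, e, pencil_comm F N G β α, ← add_mul, hab, one_mul] at key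
  exact key

/-! ### Simplification of roots by `P ↦ P - ε P'` -/

theorem laguerre_prod (s : Multiset ℝ) (x : ℝ) :
    0 ≤ (derivative (s.map fun a => X - C a).prod).eval x ^ 2 -
      (s.map fun a => X - C a).prod.eval x *
        (derivative (derivative (s.map fun a => X - C a).prod)).eval x ∧
      (s ≠ 0 → (s.map fun a => X - C a).prod.eval x ≠ 0 →
        0 < (derivative (s.map fun a => X - C a).prod).eval x ^ 2 -
          (s.map fun a => X - C a).prod.eval x *
            (derivative (derivative (s.map fun a => X - C a).prod)).eval x) := by
  induction s using Multiset.induction_on with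
  | empty => simp
  | cons r s ih =>
    rw [Multiset.map_cons, Multiset.prod_cons]
    set k := (s.map fun a => X - C a).prod
    have e : (derivative ((X - C r) * k)).eval x ^ 2 - ((X - C r) * k).eval x *
        (derivative (derivative ((X - C r) * k))).eval x =
        k.eval x ^ 2 + (x - r) ^ 2 * (k.derivative.eval x ^ 2 -
          k.eval x * k.derivative.derivative.eval x) := by
      simp [derivative_mul]
      ring
    rw [e]
    have h2 := mul_nonneg (sq_nonneg (x - r)) ih.1
    refine ⟨by positivity, fun _ h => ?_⟩
    have hk : k.eval x ≠ 0 := by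
      rw [eval_mul] at h
      exact right_ne_zero_of_mul h
    have := sq_pos_of_ne_zero hk
    linarith

theorem rootMultiplicity_shiftDeriv_le {P : ℝ[X]} (hP : P.Monic)
    (hr : Multiset.card P.roots = P.natDegree) {ε : ℝ} (hε : ε ≠ 0) (a : ℝ) :
    (shiftDeriv ε P).rootMultiplicity a ≤ max (P.rootMultiplicity a - 1) 1 := by
  have hne : shiftDeriv ε P ≠ 0 := (shiftDeriv_monic_natDegree ε hP).1.ne_zero
  by_cases h0 : P.natDegree = 0
  · have : P = 1 := hP.natDegree_eq_zero.mp h0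
    subst this
    have : shiftDeriv ε 1 = C 1 := by simp [shiftDeriv]
    rw [this, rootMultiplicity_C]
    exact Nat.zero_le _
  by_cases ha : P.IsRoot a
  · refine le_max_of_le_left ?_
    by_contra! hlt
    have hpos : 0 < P.rootMultiplicity a := (rootMultiplicity_pos hP.ne_zero).mpr ha
    have h1 : (X - C a) ^ P.rootMultiplicity a ∣ shiftDeriv ε P :=
      (le_rootMultiplicity_iff hne).mp (by omega)
    have h2 : (X - C a) ^ P.rootMultiplicity a ∣ C ε * derivative P := by
      have := dvd_sub (pow_rootMultiplicity_dvd P a) h1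
      rwa [shiftDeriv, sub_sub_cancel] at this
    have h3 : (X - C a) ^ P.rootMultiplicity a ∣ derivative P :=
      (IsUnit.dvd_mul_left (isUnit_C.mpr hε.isUnit)).mp h2
    have hd0 : derivative P ≠ 0 := fun h => h0 (derivative_eq_zero.mp h)
    have h4 := (le_rootMultiplicity_iff hd0).mpr h3
    rw [derivative_rootMultiplicity_of_root ha] at h4
    omega
  · refine le_max_of_le_right ?_
    by_contra! hlt
    obtain ⟨Q, hQ⟩ := (le_rootMultiplicity_iff hne).mp hlt
    have e1 : P.eval a - ε * P.derivative.eval a = 0 := by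
      have := congrArg (eval a) hQ
      simpa [shiftDeriv] using this
    have e2 : P.derivative.eval a - ε * P.derivative.derivative.eval a = 0 := by
      have := congrArg (fun f => eval a (derivative f)) hQ
      simpa [shiftDeriv, derivative_mul, derivative_pow] using this
    have hlag := (laguerre_prod P.roots a).2 (by
      intro h
      rw [h, Multiset.card_zero] at hr
      exact h0 hr.symm)
    rw [eq_prod_of_card_roots hP hr] at hlag
    have := hlag ha
    rw [sub_eq_zero] at e1 e2
    rw [e1] at this
    nth_rewrite 1 [sq, e2] at this
    linarith

theorem StableTriple.iterate_shiftDeriv {n : ℕ} {F N G : ℝ[X]} (h : StableTriple n F N G) (ε : ℝ)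
    (j : ℕ) : StableTriple n ((_root_.shiftDeriv ε)^[j] F) ((_root_.shiftDeriv ε)^[j] N)
      ((_root_.shiftDeriv ε)^[j] G) := by
  induction j with
  | zero => exact h
  | succ j ih =>
    simp only [Function.iterate_succ_apply']
    exact ih.shiftDeriv ε

theorem iterate_shiftDeriv_pencil (ε : ℝ) (F N G : ℝ[X]) (α β : ℝ) (j : ℕ) :
    (shiftDeriv ε)^[j] (pencil F N G α β) =
      pencil ((shiftDeriv ε)^[j] F) ((shiftDeriv ε)^[j] N) ((shiftDeriv ε)^[j] G) α β := by
  induction j with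
  | zero => rfl
  | succ j ih => simp only [Function.iterate_succ_apply', ih, shiftDeriv_pencil]

theorem StableTriple.card_roots_trd {n : ℕ} {F N G : ℝ[X]} (h : StableTriple n F N G) :
    Multiset.card G.roots = G.natDegree :=
  card_roots_of_upperFree (upperFree_map_iff.mpr h.ne_zero_trd)

theorem StableTriple.nodup_roots_iterate {n : ℕ} {F N G : ℝ[X]} (h : StableTriple n F N G) {ε : ℝ}
    (hε : ε ≠ 0) : ((_root_.shiftDeriv ε)^[n] G).roots.Nodup := by
  have key : ∀ j a, ((_root_.shiftDeriv ε)^[j] G).rootMultiplicity a ≤ max (n - j) 1 := by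
    intro j
    induction j with
    | zero =>
      intro a
      rw [← count_roots]
      exact le_max_of_le_left ((Multiset.count_le_card _ _).trans
        (by simp [h.card_roots_trd, h.natDegree_trd]))
    | succ j ih =>
      intro a
      rw [Function.iterate_succ_apply']
      have hj := h.iterate_shiftDeriv ε j
      have := rootMultiplicity_shiftDeriv_le hj.monic_trd hj.card_roots_trd hε a
      have := ih a
      omega
  rw [Multiset.nodup_iff_count_le_one]
  intro a
  rw [count_roots]
  simpa using key n a

/-! ### Continuity of symmetric sums of roots -/

theorem exists_eq_map_univ {s : Multiset ℝ} {m : ℕ} (hs : Multiset.card s = m) :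
    ∃ v : Fin m → ℝ, s = Finset.univ.val.map v := by
  obtain rfl : s.toList.length = m := (Multiset.length_toList s).trans hs
  exact ⟨s.toList.get, by rw [Fin.univ_val_map, List.ofFn_get, Multiset.coe_toList]⟩

section

open Filter Topology

theorem continuous_coeff_iterate_shiftDeriv (P : ℝ[X]) (j i : ℕ) :
    Continuous fun ε : ℝ => ((shiftDeriv ε)^[j] P).coeff i := by
  induction j generalizing i with
  | zero => exact continuous_const
  | succ j ih =>
    simp only [Function.iterate_succ_apply', shiftDeriv, coeff_sub, coeff_C_mul, coeff_derivative]
    exact (ih i).sub (continuous_id.mul ((ih (i + 1)).mul continuous_const))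

theorem iterate_shiftDeriv_zero (P : ℝ[X]) (j : ℕ) : (shiftDeriv 0)^[j] P = P := by
  induction j with
  | zero => rfl
  | succ j ih => rw [Function.iterate_succ_apply', ih, shiftDeriv, C_0, zero_mul, sub_zero]

theorem abs_root_le {P : ℝ[X]} (hP : P.Monic) {x : ℝ} (hx : x ∈ P.roots) :
    |x| ≤ ∑ i ∈ Finset.range P.natDegree, |P.coeff i| + 1 := by
  have h1 := IsRoot.norm_lt_cauchyBound hP.ne_zero (isRoot_of_mem_roots hx)
  have h2 : P.cauchyBound ≤ ∑ i ∈ Finset.range P.natDegree, ‖P.coeff i‖₊ + 1 := by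
    rw [cauchyBound, hP.leadingCoeff, nnnorm_one, div_one]
    gcongr
    exact Finset.sup_le fun i hi =>
      Finset.single_le_sum (f := fun i => ‖P.coeff i‖₊) (fun _ _ => zero_le) hi
  have h3 := (h1.trans_le h2).le
  have h4 : (‖x‖₊ : ℝ) ≤ ((∑ i ∈ Finset.range P.natDegree, ‖P.coeff i‖₊ + 1 : NNReal) : ℝ) := by
    exact_mod_cast h3
  simpa using h4

theorem tendsto_sum_roots {m : ℕ} {f : ℕ → ℝ[X]} {g : ℝ[X]} (hf : ∀ k, (f k).Monic)
    (hfd : ∀ k, (f k).natDegree = m) (hfr : ∀ k, Multiset.card (f k).roots = m)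
    (hgd : g.natDegree = m)
    (hlim : ∀ i, Tendsto (fun k => (f k).coeff i) atTop (𝓝 (g.coeff i))) {φ : ℝ → ℝ}
    (hφ : Continuous φ) :
    Tendsto (fun k => ((f k).roots.map φ).sum) atTop (𝓝 (g.roots.map φ).sum) := by
  choose v hv using fun k => exists_eq_map_univ (hfr k)
  obtain ⟨B, hB⟩ : ∃ B : ℝ, ∀ k i, |v k i| ≤ B := by
    have ht : Tendsto (fun k => ∑ i ∈ Finset.range m, |(f k).coeff i| + 1) atTop
        (𝓝 (∑ i ∈ Finset.range m, |g.coeff i| + 1)) :=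
      (tendsto_finsetSum _ fun i _ => (hlim i).abs).add_const 1
    obtain ⟨B, hB⟩ := ht.bddAbove_range
    refine ⟨B, fun k i => (abs_root_le (hf k) ?_).trans ?_⟩
    · rw [hv k]
      exact Multiset.mem_map_of_mem _ (Finset.mem_univ i)
    · rw [hfd k]
      exact hB ⟨k, rfl⟩
  have hprod : ∀ k, f k = ∏ i, (X - C (v k i)) := by
    intro k
    conv_lhs => rw [← eq_prod_of_card_roots (hf k) (by rw [hfr, hfd]), hv k]
    rw [Multiset.map_map]
    rfl
  refine tendsto_of_subseq_tendsto fun ns hns => ?_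
  have hcomp : IsCompact (Set.univ.pi fun _ : Fin m => Set.Icc (-B) B) :=
    isCompact_univ_pi fun _ => isCompact_Icc
  obtain ⟨u, -, ms, hms, hu⟩ := hcomp.tendsto_subseq (x := fun k => v (ns k)) fun k i _ =>
    abs_le.mp (hB _ i)
  refine ⟨ms, ?_⟩
  have hui : ∀ i, Tendsto (fun k => v (ns (ms k)) i) atTop (𝓝 (u i)) := fun i =>
    (tendsto_pi_nhds.mp hu) i
  have hg : g = ∏ i, (X - C (u i)) := by
    refine Polynomial.funext fun x => ?_
    have h1 : Tendsto (fun k => (f (ns (ms k))).eval x) atTop (𝓝 (g.eval x)) := by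
      simp only [eval_eq_sum_range, hfd, hgd]
      exact tendsto_finsetSum _ fun i _ =>
        ((hlim i).comp (hns.comp hms.tendsto_atTop)).mul_const _
    have h2 : Tendsto (fun k => (f (ns (ms k))).eval x) atTop
        (𝓝 ((∏ i, (X - C (u i))).eval x)) := by
      simp only [hprod, eval_prod, eval_sub, eval_X, eval_C]
      exact tendsto_finsetProd _ fun i _ => (hui i).const_sub x
    exact tendsto_nhds_unique h1 h2
  have hgr : g.roots = Finset.univ.val.map u := by
    rw [hg, roots_prod _ _ (Finset.prod_ne_zero_iff.mpr fun i _ => X_sub_C_ne_zero _)]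
    simp
  have h3 : Tendsto (fun k => ∑ i, φ (v (ns (ms k)) i)) atTop (𝓝 (∑ i, φ (u i))) :=
    tendsto_finsetSum _ fun i _ => (hφ.tendsto _).comp (hui i)
  simp only [hv, hgr, Multiset.map_map]
  exact h3

theorem StableTriple.convMaj {n : ℕ} {F N G : ℝ[X]} (h : StableTriple n F N G)
    {a b : ℝ} (ha : 0 ≤ a) (hb : 0 ≤ b) (hab : a + b = 1) (α β : ℝ) :
    ConvMaj (pencil F N G α β).roots (pencil F N G (a * α + b * β) (a * β + b * α)).roots := by
  intro φ hφ
  have hφc : Continuous φ := continuousOn_univ.mp (hφ.continuousOn isOpen_univ)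
  set ε : ℕ → ℝ := fun k => 1 / ((k : ℝ) + 1) with hε
  have hε0 : ∀ k, ε k ≠ 0 := fun k => by
    simp only [hε]
    positivity
  have hlim : ∀ x y : ℝ, Tendsto
      (fun k => (((_root_.shiftDeriv (ε k))^[n] (pencil F N G x y)).roots.map φ).sum) atTop
      (𝓝 ((pencil F N G x y).roots.map φ).sum) := by
    intro x y
    refine tendsto_sum_roots (m := n + 2) ?_ ?_ ?_ (pencil_monic_natDegree h x y).2 (fun i => ?_)
      hφc
    · intro k
      rw [iterate_shiftDeriv_pencil]
      exact (pencil_monic_natDegree (h.iterate_shiftDeriv (ε k) n) x y).1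
    · intro k
      rw [iterate_shiftDeriv_pencil]
      exact (pencil_monic_natDegree (h.iterate_shiftDeriv (ε k) n) x y).2
    · intro k
      rw [iterate_shiftDeriv_pencil]
      exact card_roots_pencil (h.iterate_shiftDeriv (ε k) n) x y
    · have hc := (continuous_coeff_iterate_shiftDeriv (pencil F N G x y) n i).tendsto 0
      rw [iterate_shiftDeriv_zero] at hc
      exact hc.comp tendsto_one_div_add_atTop_nhds_zero_nat
  refine le_of_tendsto_of_tendsto' (hlim _ _) (hlim _ _) fun k => ?_
  rw [iterate_shiftDeriv_pencil, iterate_shiftDeriv_pencil]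
  exact (h.iterate_shiftDeriv (ε k) n).convMaj_of_nodup (h.nodup_roots_iterate (hε0 k)) ha hb hab
    α β φ hφ

end

/-! ### From convex majorization to majorization -/

theorem sum_drop_sub_le_sum_hinge (L : List ℝ) (a : ℝ) (d : ℕ) :
    (L.drop d).sum - (L.length - d : ℕ) * a ≤ (L.map fun t => max (t - a) 0).sum := by
  have hlow : ∀ l : List ℝ, l.sum - l.length * a ≤ (l.map fun t => max (t - a) 0).sum := by
    intro l
    induction l with
    | nil => simp
    | cons b l ih =>
      simp only [List.sum_cons, List.map_cons, List.length_cons, Nat.cast_add, Nat.cast_one]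
      linarith [le_max_left (b - a) 0]
  have hnn : 0 ≤ ((L.take d).map fun t => max (t - a) 0).sum := by
    apply List.sum_nonneg
    intro u hu
    obtain ⟨t, -, rfl⟩ := List.mem_map.mp hu
    exact le_max_right _ _
  have hsplit : (L.map fun t => max (t - a) 0).sum =
      ((L.take d).map fun t => max (t - a) 0).sum +
        ((L.drop d).map fun t => max (t - a) 0).sum := by
    rw [← List.sum_append, ← List.map_append, List.take_append_drop]
  have := hlow (L.drop d)
  rw [List.length_drop] at this
  linarith

theorem sum_hinge_eq_of_sorted {L : List ℝ} (hL : L.Pairwise (· ≤ ·)) {d : ℕ} {a : ℝ} {T : List ℝ}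
    (hT : L.drop d = a :: T) :
    (L.map fun t => max (t - a) 0).sum = (L.drop d).sum - (L.length - d : ℕ) * a := by
  have hup : ∀ l : List ℝ, (∀ t ∈ l, a ≤ t) →
      (l.map fun t => max (t - a) 0).sum = l.sum - l.length * a := by
    intro l hl
    induction l with
    | nil => simp
    | cons b l ih =>
      simp only [List.sum_cons, List.map_cons, List.length_cons, Nat.cast_add, Nat.cast_one]
      rw [ih fun t ht => hl t (List.mem_cons_of_mem _ ht),
        max_eq_left (by linarith [hl b List.mem_cons_self])]
      ring
  have hdown : ∀ l : List ℝ, (∀ t ∈ l, t ≤ a) → (l.map fun t => max (t - a) 0).sum = 0 := by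
    intro l hl
    induction l with
    | nil => simp
    | cons b l ih =>
      simp only [List.sum_cons, List.map_cons]
      rw [ih fun t ht => hl t (List.mem_cons_of_mem _ ht),
        max_eq_right (by linarith [hl b List.mem_cons_self]), add_zero]
  have hsplit : (L.map fun t => max (t - a) 0).sum =
      ((L.take d).map fun t => max (t - a) 0).sum +
        ((L.drop d).map fun t => max (t - a) 0).sum := by
    rw [← List.sum_append, ← List.map_append, List.take_append_drop]
  have hpw : (L.take d ++ L.drop d).Pairwise (· ≤ ·) := by rwa [List.take_append_drop]
  rw [List.pairwise_append] at hpw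
  obtain ⟨-, hdrop, hcross⟩ := hpw
  rw [hsplit, hdown _ fun t ht => hcross t ht a (by rw [hT]; exact List.mem_cons_self), zero_add,
    hup, List.length_drop]
  intro t ht
  rw [hT] at ht hdrop
  rcases List.mem_cons.mp ht with rfl | ht
  · exact le_rfl
  · exact (List.pairwise_cons.mp hdrop).1 t ht

theorem ConvMaj.majorizes {x y : Multiset ℝ} (h : ConvMaj x y) : Majorizes x y := by
  have hcard : Multiset.card x = Multiset.card y := by
    have h1 := h (fun _ => 1) (convexOn_const _ convex_univ)
    have h2 := h (fun _ => -1) (convexOn_const _ convex_univ)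
    simp only [Multiset.map_const', Multiset.sum_replicate, nsmul_eq_mul, mul_one, mul_neg,
      neg_le_neg_iff, Nat.cast_le] at h1 h2
    exact le_antisymm h2 h1
  have hsum : x.sum = y.sum := by
    have h1 := h id (convexOn_id convex_univ)
    have h2 := h (fun t => -id t) (concaveOn_id convex_univ).neg
    simp only [id, Multiset.sum_map_neg', Multiset.map_id', neg_le_neg_iff]
      at h1 h2
    exact le_antisymm h2 h1
  refine ⟨hcard, hsum, fun k => ?_⟩
  rcases Nat.lt_or_ge k (Multiset.card x) with hk | hk
  · rcases Nat.eq_zero_or_pos k with rfl | hk0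
    · rw [List.drop_eq_nil_of_le (by simp), List.drop_eq_nil_of_le (by simp)]
    · obtain ⟨a, T, hT⟩ := List.exists_cons_of_ne_nil
        (l := (x.sort (· ≤ ·)).drop (Multiset.card x - k))
        (by rw [Ne, List.drop_eq_nil_iff, Multiset.length_sort]; omega)
      have hconv : ConvexOn ℝ Set.univ fun t : ℝ => max (t - a) 0 :=
        ((convexOn_id convex_univ).sub (concaveOn_const a convex_univ)).sup
          (convexOn_const 0 convex_univ)
      have hφ := h _ hconv
      have hx := sum_hinge_eq_of_sorted (Multiset.pairwise_sort x (· ≤ ·)) hT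
      have hy := sum_drop_sub_le_sum_hinge (y.sort (· ≤ ·)) a (Multiset.card y - k)
      have key : ∀ s : Multiset ℝ, (s.map fun t => max (t - a) 0).sum =
          ((s.sort (· ≤ ·)).map fun t => max (t - a) 0).sum := by
        intro s
        conv_lhs => rw [← Multiset.sort_eq s (· ≤ ·)]
        rw [Multiset.map_coe, Multiset.sum_coe]
      rw [key, key, hx] at hφ
      rw [Multiset.length_sort] at hφ hy
      rw [hcard] at hφ ⊢
      linarith
  · have key : ∀ s : Multiset ℝ, (s.sort (· ≤ ·)).sum = s.sum := by
      intro s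
      conv_rhs => rw [← Multiset.sort_eq s (· ≤ ·), Multiset.sum_coe]
    rw [Nat.sub_eq_zero_of_le hk, Nat.sub_eq_zero_of_le (hcard ▸ hk), List.drop_zero,
      List.drop_zero, key, key, hsum]

theorem card_roots_prod_X_sub_C {ι : Type*} (S : Finset ι) (v : ι → ℝ) :
    Multiset.card (∏ i ∈ S, (X - C (v i))).roots = S.card := by
  have h : ∏ i ∈ S, (X - C (v i)) = ((S.val.map v).map fun a => X - C a).prod := by
    rw [Multiset.map_map]
    rfl
  rw [h, roots_multiset_prod_X_sub_C, Multiset.card_map, Finset.card_val]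

/-! ### Moving the roots of the second factor together -/

/-- Moving two roots of `q` towards each other moves the roots of `p ⊞ q` down in the majorization
order. -/
theorem convMaj_boxplus_update {m : ℕ} {p : ℝ[X]} (hp : p.Monic) (hpd : p.natDegree = m)
    (hproots : Multiset.card p.roots = m) (x : Fin m → ℝ) {i j : Fin m} (hij : i ≠ j) {δ : ℝ}
    (hδ : 0 ≤ δ) (hδx : δ ≤ x i - x j) :
    ConvMaj (boxplus m p (∏ k, (X - C (x k)))).roots
      (boxplus m p (∏ k, (X - C (Function.update (Function.update x i (x i - δ)) j
        (x j + δ) k)))).roots := by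
  obtain ⟨n, rfl⟩ : ∃ n, m = n + 2 := by
    refine ⟨m - 2, ?_⟩
    have := i.2
    have := j.2
    have := Fin.val_ne_iff.mpr hij
    omega
  set S : Finset (Fin (n + 2)) := (Finset.univ.erase i).erase j with hS
  have hjS : j ∈ Finset.univ.erase i := Finset.mem_erase.mpr ⟨hij.symm, Finset.mem_univ j⟩
  have hsplit : ∀ y : Fin (n + 2) → ℝ, ∏ k, (X - C (y k)) =
      (X - C (y i)) * ((X - C (y j)) * ∏ k ∈ S, (X - C (y k))) := fun y => by
    rw [Finset.mul_prod_erase _ (fun k => X - C (y k)) hjS,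
      Finset.mul_prod_erase _ (fun k => X - C (y k)) (Finset.mem_univ i)]
  set h : ℝ[X] := ∏ k ∈ S, (X - C (x k)) with hh
  have hcardS : S.card = n := by
    rw [hS, Finset.card_erase_of_mem hjS, Finset.card_erase_of_mem (Finset.mem_univ i)]
    simp
  have hhd : h.natDegree = n := by rw [hh, natDegree_finsetProd_X_sub_C_eq_card, hcardS]
  have hhr : Multiset.card h.roots = n := by
    rw [hh, card_roots_prod_X_sub_C, hcardS]
  have hst := stableTriple_boxplus hp hpd hproots (monic_prod_X_sub_C _ _) hhd hhr
  set b : ℝ := δ / (x i - x j) with hb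
  have hbD : b * (x i - x j) = δ := by
    rcases eq_or_ne (x i - x j) 0 with h0 | h0
    · rw [h0] at hδx ⊢
      linarith
    · rw [hb, div_mul_cancel₀ _ h0]
  have hD : 0 ≤ x i - x j := hδ.trans hδx
  have key := hst.convMaj (a := 1 - b) (b := b) (sub_nonneg.mpr (div_le_one_of_le₀ hδx hD))
    (div_nonneg hδ hD) (by ring) (x i) (x j)
  rw [← boxplus_two_roots, ← boxplus_two_roots] at key
  have hz : ∏ k ∈ S, (X - C (Function.update (Function.update x i (x i - δ)) j (x j + δ) k)) = h :=
    Finset.prod_congr rfl fun k hk => by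
      have hkj := Finset.ne_of_mem_erase hk
      have hki := Finset.ne_of_mem_erase (Finset.mem_of_mem_erase hk)
      rw [Function.update_of_ne hkj, Function.update_of_ne hki]
  rw [hsplit x, hsplit, hz, Function.update_self, Function.update_of_ne hij, Function.update_self]
  convert key using 7
  · linear_combination hbD
  · linear_combination -hbD

/-- If `y` is obtained from `x` by moving coordinates towards zero with the sum preserved, then the
roots of the convolution with root vector `x` majorize those with root vector `y`. -/
theorem convMaj_boxplus_prod {m : ℕ} {p : ℝ[X]} (hp : p.Monic) (hpd : p.natDegree = m)
    (hproots : Multiset.card p.roots = m) (y : Fin m → ℝ) :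
    ∀ x : Fin m → ℝ, ∑ i, x i = ∑ i, y i → (∀ i, y i < x i → 0 ≤ y i) →
      (∀ i, x i < y i → y i ≤ 0) →
      ConvMaj (boxplus m p (∏ k, (X - C (x k)))).roots
        (boxplus m p (∏ k, (X - C (y k)))).roots := by
  intro x
  induction hN : (Finset.univ.filter fun i => x i ≠ y i).card using Nat.strong_induction_on
    generalizing x with
  | _ N ih =>
  intro hsum hpos hneg
  by_cases hxy : x = y
  · rw [hxy]
    exact ConvMaj.refl _
  obtain ⟨i, hi⟩ : ∃ i, y i < x i := by
    by_contra! hle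
    exact hxy (funext fun i =>
      (Finset.sum_eq_sum_iff_of_le fun i _ => hle i).mp hsum i (Finset.mem_univ i))
  obtain ⟨j, hj⟩ : ∃ j, x j < y j := by
    by_contra! hle
    exact hxy (funext fun i =>
      ((Finset.sum_eq_sum_iff_of_le fun i _ => hle i).mp hsum.symm i (Finset.mem_univ i)).symm)
  have hij : i ≠ j := by
    rintro rfl
    exact lt_asymm hi hj
  have hyi := hpos i hi
  have hyj := hneg j hj
  set δ : ℝ := min (x i - y i) (y j - x j) with hδ
  have hδi : δ ≤ x i - y i := min_le_left _ _
  have hδj : δ ≤ y j - x j := min_le_right _ _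
  have hδ0 : 0 ≤ δ := le_min (by linarith) (by linarith)
  refine (convMaj_boxplus_update hp hpd hproots x hij hδ0 (by linarith)).trans ?_
  set z := Function.update (Function.update x i (x i - δ)) j (x j + δ) with hz
  have hzj : z j = x j + δ := by rw [hz, Function.update_self]
  have hzi : z i = x i - δ := by rw [hz, Function.update_of_ne hij, Function.update_self]
  have hzk : ∀ k, k ≠ i → k ≠ j → z k = x k := fun k hki hkj => by
    rw [hz, Function.update_of_ne hkj, Function.update_of_ne hki]
  refine ih _ ?_ z rfl ?_ ?_ ?_
  · rw [← hN]
    apply Finset.card_lt_card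
    rw [Finset.ssubset_iff_of_subset]
    · rcases min_choice (x i - y i) (y j - x j) with hmin | hmin
      · refine ⟨i, by simpa using hi.ne', ?_⟩
        simp only [Finset.mem_filter, Finset.mem_univ, true_and, not_not]
        rw [hzi, hδ, hmin]
        ring
      · refine ⟨j, by simpa using hj.ne, ?_⟩
        simp only [Finset.mem_filter, Finset.mem_univ, true_and, not_not]
        rw [hzj, hδ, hmin]
        ring
    · intro k hk
      simp only [Finset.mem_filter, Finset.mem_univ, true_and] at hk ⊢
      by_cases hki : k = i
      · rw [hki]
        exact hi.ne'
      by_cases hkj : k = j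
      · rw [hkj]
        exact hj.ne
      rwa [hzk k hki hkj] at hk
  · rw [← hsum, ← sub_eq_zero, ← Finset.sum_sub_distrib,
      Finset.sum_eq_add_of_mem i j (Finset.mem_univ i) (Finset.mem_univ j) hij]
    · rw [hzi, hzj]
      ring
    · rintro k - ⟨hki, hkj⟩
      rw [hzk k hki hkj, sub_self]
  · intro k hk
    by_cases hki : k = i
    · rw [hki]
      exact hyi
    by_cases hkj : k = j
    · rw [hkj, hzj] at hk
      linarith
    rw [hzk k hki hkj] at hk
    exact hpos k hk
  · intro k hk
    by_cases hki : k = i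
    · rw [hki, hzi] at hk
      linarith
    by_cases hkj : k = j
    · rw [hkj]
      exact hyj
    rw [hzk k hki hkj] at hk
    exact hneg k hk

/-! ### Scaled roots -/

theorem scaleRoots_prod_X_sub_C {ι : Type*} (S : Finset ι) (v : ι → ℝ) (t : ℝ) :
    (∏ i ∈ S, (X - C (v i))).scaleRoots t = ∏ i ∈ S, (X - C (t * v i)) := by
  classical
  induction S using Finset.induction_on with
  | empty => simp
  | insert i S hi ih =>
    rw [Finset.prod_insert hi, Finset.prod_insert hi, mul_scaleRoots_of_noZeroDivisors, ih,
      X_sub_C_scaleRoots, mul_comm t]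

theorem card_roots_boxplus {m : ℕ} {p q : ℝ[X]} (hp : p.Monic) (hq : q.Monic)
    (hpd : p.natDegree = m) (hqd : q.natDegree = m) (hproots : Multiset.card p.roots = m)
    (hqroots : Multiset.card q.roots = m) : Multiset.card (boxplus m p q).roots = m := by
  rw [card_roots_of_upperFree (upperFree_boxplus hp hq hpd hqd hproots hqroots),
    (boxplus_monic_natDegree hp hpd hq hqd le_rfl).2]

/-- **Monotone majorization for scaled convolutions.** Let `p`, `q` be monic real-rooted
real polynomials of degree `m` with the roots of `q` summing to `0`. For `t ≥ 0` let
`q_t(x) = t^m q(x/t)` (i.e. `q.scaleRoots t`, which is `x^m` for `t = 0`) and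
`r_t = [p ⊞_m q_t]`. Then for all `t ≥ s ≥ 0`, both `r_t` and `r_s` are real rooted and
the roots of `r_t` majorize the roots of `r_s`. -/
theorem boxplus_scaled_roots_majorize (m : ℕ) (p q : ℝ[X])
    (hp : p.Monic) (hq : q.Monic) (hpd : p.natDegree = m) (hqd : q.natDegree = m)
    (hproots : Multiset.card p.roots = m) (hqroots : Multiset.card q.roots = m)
    (hqsum : q.roots.sum = 0)
    (s t : ℝ) (hs : 0 ≤ s) (hst : s ≤ t) :
    Multiset.card (boxplus m p (q.scaleRoots t)).roots = m ∧
      Multiset.card (boxplus m p (q.scaleRoots s)).roots = m ∧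
      Majorizes (boxplus m p (q.scaleRoots t)).roots
        (boxplus m p (q.scaleRoots s)).roots := by
  obtain ⟨v, hv⟩ := exists_eq_map_univ hqroots
  have hqprod : q = ∏ i, (X - C (v i)) := by
    rw [← eq_prod_of_card_roots hq (hqroots.trans hqd.symm), hv, Multiset.map_map]
    rfl
  have hv0 : ∑ i, v i = 0 := by
    rw [hv] at hqsum
    exact hqsum
  have hscale : ∀ u, q.scaleRoots u = ∏ i, (X - C (u * v i)) := fun u => by
    rw [hqprod, scaleRoots_prod_X_sub_C]
  have hcard : ∀ u, Multiset.card (boxplus m p (q.scaleRoots u)).roots = m := fun u => by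
    refine card_roots_boxplus hp ((monic_scaleRoots_iff u).mpr hq) hpd
      ((natDegree_scaleRoots q u).trans hqd) hproots ?_
    rw [hscale, card_roots_prod_X_sub_C, Finset.card_fin]
  refine ⟨hcard t, hcard s, ConvMaj.majorizes ?_⟩
  rw [hscale, hscale]
  refine convMaj_boxplus_prod hp hpd hproots _ _ ?_ (fun i hi => ?_) fun i hi => ?_
  · rw [← Finset.mul_sum, ← Finset.mul_sum, hv0, mul_zero, mul_zero]
  · refine mul_nonneg hs ?_
    by_contra! h
    nlinarith
  · refine mul_nonpos_of_nonneg_of_nonpos hs ?_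
    by_contra! h
    nlinarith
end

section
/- (Finite free central limit theorem.) Let σ > 0, m ≥ 2, and let p_1, p_2, … be a sequence of monic real polynomials, each of degree m with all roots real, such that for every i the sum of the roots of p_i equals 0 and the sum of the squares of the roots of p_i equals mσ². For each positive integer n and each 1 ≤ i ≤ n let q_{i,n}(x) = n^{−m/2} p_i(√n · x), and set r_n = [q_{1,n} ⊞_m q_{2,n} ⊞_m ⋯ ⊞_m q_{n,n}]. Then r_n converges coefficientwise to 𝔑_m[0, σ²](x) := (σ²/(m−1))^{m/2} · He_m( x · √((m−1)/σ²) ) as n → ∞, where He_m is the m-th probabilist's Hermite polynomial (the monic degree-m polynomial orthogonal with respect to the weight e^{−x²/2}). -/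
open Polynomial

/-- The iterated symmetric additive convolution of a list of polynomials
(`x^m` is the identity element for `⊞_m` on monic degree-`m` polynomials). -/
noncomputable def boxplusList (m : ℕ) (l : List ℝ[X]) : ℝ[X] :=
  l.foldr (boxplus m) ((X : ℝ[X]) ^ m)

/-- The finite free Gaussian
`𝔑_m[0, σ²](x) = (σ²/(m-1))^{m/2} · He_m(x √((m-1)/σ²))`, where `He_m` is the `m`-th
probabilist's Hermite polynomial (`Polynomial.hermite m`). -/
noncomputable def finiteGaussian (m : ℕ) (σ : ℝ) : ℝ[X] :=
  C (Real.sqrt (σ ^ 2 / ((m : ℝ) - 1)) ^ m) *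
    ((Polynomial.hermite m).map (Int.castRingHom ℝ)).comp
      (C (Real.sqrt (((m : ℝ) - 1) / σ ^ 2)) * X)

open scoped PowerSeries

open Filter Asymptotics Topology

/-- The power series `∑ k ≤ m, a k * D ^ k` for which `p = ∑ k ≤ m, a k * D ^ k (x ^ m)`. -/
noncomputable def derivativeSymbol (m : ℕ) (p : ℝ[X]) : ℝ⟦X⟧ :=
  PowerSeries.mk fun k =>
    if k ≤ m then p.coeff (m - k) * (m - k).factorial / m.factorial else 0

lemma coeff_derivativeSymbol {m k : ℕ} (hk : k ≤ m) (p : ℝ[X]) :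
    PowerSeries.coeff k (derivativeSymbol m p) =
      p.coeff (m - k) * (m - k).factorial / m.factorial := by
  simp [derivativeSymbol, hk]

lemma coeff_derivativeSymbol_of_lt {m k : ℕ} (hk : m < k) (p : ℝ[X]) :
    PowerSeries.coeff k (derivativeSymbol m p) = 0 := by
  simp [derivativeSymbol, hk.not_ge]

lemma boxplus_eq_sum_derivativeSymbol (m : ℕ) (p q : ℝ[X]) :
    boxplus m p q = ∑ i ∈ Finset.range (m + 1),
      C (PowerSeries.coeff i (derivativeSymbol m q)) * derivative^[i] p := by
  rw [boxplus, Finset.smul_sum]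
  refine Finset.sum_congr rfl fun i hi => ?_
  have hi : i ≤ m := Nat.lt_succ_iff.mp (Finset.mem_range.mp hi)
  rw [smul_eq_C_mul, ← mul_assoc, ← C_mul, coeff_derivativeSymbol hi,
    ← coeff_zero_eq_eval_zero, coeff_iterate_derivative]
  simp only [zero_add, Nat.descFactorial_self, nsmul_eq_mul]
  congr 2
  ring

lemma coeff_derivativeSymbol_boxplus {m k : ℕ} (hk : k ≤ m) {p : ℝ[X]} (hp : p.natDegree ≤ m)
    (q : ℝ[X]) :
    PowerSeries.coeff k (derivativeSymbol m (boxplus m p q)) =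
      PowerSeries.coeff k (derivativeSymbol m p * derivativeSymbol m q) := by
  rw [mul_comm, PowerSeries.coeff_mul,
    Finset.Nat.sum_antidiagonal_eq_sum_range_succ
      (fun i j => PowerSeries.coeff i (derivativeSymbol m q) *
        PowerSeries.coeff j (derivativeSymbol m p)),
    coeff_derivativeSymbol hk, boxplus_eq_sum_derivativeSymbol, finsetSum_coeff,
    Finset.sum_mul, Finset.sum_div]
  symm
  refine Finset.sum_subset_zero_on_sdiff (Finset.range_mono (by omega)) (fun i hi => ?_)
    fun i hi => ?_
  · have hik : k < i := by simpa using (Finset.mem_sdiff.mp hi).2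
    rw [coeff_C_mul, coeff_iterate_derivative,
      coeff_eq_zero_of_natDegree_lt (by omega)]
    simp
  · have hik : i ≤ k := by simpa [Nat.lt_succ_iff] using hi
    obtain ⟨d, rfl⟩ := Nat.exists_eq_add_of_le hik
    obtain ⟨e, rfl⟩ := Nat.exists_eq_add_of_le hk
    have h1 : i + d + e - (i + d) = e := by omega
    have h2 : i + d + e - d = e + i := by omega
    have h3 : (e.factorial : ℝ) * (e + i).descFactorial i = (e + i).factorial := by
      have := Nat.factorial_mul_descFactorial (Nat.le_add_left i e)
      rw [Nat.add_sub_cancel] at this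
      exact_mod_cast this
    rw [Nat.add_sub_cancel_left, coeff_derivativeSymbol (show d ≤ i + d + e by omega),
      coeff_C_mul, coeff_iterate_derivative, h1, h2, nsmul_eq_mul, ← h3]
    ring

lemma coeff_derivativeSymbol_boxplusList {m : ℕ} {l : List ℝ[X]}
    (hl : ∀ p ∈ l, p.natDegree ≤ m) {k : ℕ} (hk : k ≤ m) :
    PowerSeries.coeff k (derivativeSymbol m (boxplusList m l)) =
      PowerSeries.coeff k (l.map (derivativeSymbol m)).prod := by
  induction l generalizing k with
  | nil =>
    rw [coeff_derivativeSymbol hk]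
    rcases Nat.eq_zero_or_pos k with rfl | hk0
    · simp [boxplusList, Nat.factorial_ne_zero]
    · simp [boxplusList, coeff_X_pow, PowerSeries.coeff_one, hk0.ne', show m - k ≠ m by omega]
  | cons p l ih =>
    change PowerSeries.coeff k (derivativeSymbol m (boxplus m p (boxplusList m l))) = _
    rw [coeff_derivativeSymbol_boxplus hk (hl p List.mem_cons_self), List.map_cons,
      List.prod_cons, PowerSeries.coeff_mul, PowerSeries.coeff_mul]
    refine Finset.sum_congr rfl fun x hx => ?_
    have := Finset.HasAntidiagonal.mem_antidiagonal.mp hx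
    rw [ih (fun q hq => hl q (List.mem_cons_of_mem _ hq)) (by omega)]

lemma derivativeSymbol_dilate (m : ℕ) (p : ℝ[X]) {s : ℝ} (hs : s ≠ 0) :
    derivativeSymbol m (C (s ^ m)⁻¹ * p.comp (C s * X)) =
      PowerSeries.rescale s⁻¹ (derivativeSymbol m p) := by
  ext k
  rw [PowerSeries.coeff_rescale]
  rcases le_or_gt k m with hk | hk
  · rw [coeff_derivativeSymbol hk, coeff_derivativeSymbol hk, coeff_C_mul,
      comp_C_mul_X_coeff]
    obtain ⟨d, rfl⟩ := Nat.exists_eq_add_of_le hk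
    rw [Nat.add_sub_cancel_left, pow_add, inv_pow]
    field_simp
  · simp [coeff_derivativeSymbol_of_lt hk]

lemma Multiset.two_mul_esymm_two {R : Type*} [CommRing R] (s : Multiset R) :
    2 * s.esymm 2 = s.sum ^ 2 - (s.map fun r => r ^ 2).sum := by
  induction s using Multiset.induction with
  | empty => simp [Multiset.esymm, Multiset.powersetCard_zero_right]
  | cons a s ih =>
    have h : (a ::ₘ s).esymm 2 = s.esymm 2 + a * s.sum := by
      simp [Multiset.esymm, Multiset.powersetCard_cons, Multiset.powersetCard_one,
        Multiset.sum_map_mul_left (s := s) (f := fun x => x)]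
    rw [h, mul_add, ih, Multiset.sum_cons, Multiset.map_cons, Multiset.sum_cons]
    ring

lemma Multiset.esymm_one_eq_sum {R : Type*} [CommRing R] (s : Multiset R) : s.esymm 1 = s.sum := by
  simp [Multiset.esymm, Multiset.powersetCard_one]

/-- Power series which solve first order linear equations up to order `m` converge when the
equations do. -/
lemma tendsto_coeff_of_derivative_eq_mul {m : ℕ} {F L : ℕ → ℝ⟦X⟧} {G M : ℝ⟦X⟧}
    (hF : ∀ᶠ n in atTop, PowerSeries.derivative ℝ (F n) = F n * L n)
    (hF0 : Tendsto (fun n => PowerSeries.coeff 0 (F n)) atTop (𝓝 (PowerSeries.coeff 0 G)))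
    (hL : ∀ k, Tendsto (fun n => PowerSeries.coeff k (L n)) atTop (𝓝 (PowerSeries.coeff k M)))
    (hG : ∀ k < m, PowerSeries.coeff k (PowerSeries.derivative ℝ G) = PowerSeries.coeff k (G * M))
    {k : ℕ} (hk : k ≤ m) :
    Tendsto (fun n => PowerSeries.coeff k (F n)) atTop (𝓝 (PowerSeries.coeff k G)) := by
  induction k using Nat.strong_induction_on with
  | _ k ih =>
  rcases k with _ | k
  · exact hF0
  have hne : ((k : ℝ) + 1) ≠ 0 := by positivity
  have key : Tendsto (fun n => PowerSeries.coeff k (F n * L n)) atTop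
      (𝓝 (PowerSeries.coeff k (G * M))) := by
    simp only [PowerSeries.coeff_mul]
    refine tendsto_finsetSum _ fun x hx => ?_
    have := Finset.HasAntidiagonal.mem_antidiagonal.mp hx
    exact (ih x.1 (by omega) (by omega)).mul (hL x.2)
  have hG' := hG k hk
  rw [PowerSeries.coeff_derivative] at hG'
  rw [← mul_div_cancel_right₀ (PowerSeries.coeff (k + 1) G) hne, hG']
  refine (key.div_const _).congr' ?_
  filter_upwards [hF] with n hn
  rw [← hn, PowerSeries.coeff_derivative, mul_div_cancel_right₀ _ hne]

/-- The logarithmic derivative `S' / S` of a power series. -/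
noncomputable def PowerSeries.logarithmicDerivative (S : ℝ⟦X⟧) : ℝ⟦X⟧ :=
  PowerSeries.derivative ℝ S * S⁻¹

namespace PowerSeries

variable {S : ℝ⟦X⟧}

lemma derivative_eq_mul_logarithmicDerivative (hS : coeff 0 S = 1) :
    derivative ℝ S = S * logarithmicDerivative S := by
  have h : S * S⁻¹ = 1 := PowerSeries.mul_inv_cancel S
    (by simp [show constantCoeff S = 1 by simpa using hS])
  rw [logarithmicDerivative, mul_left_comm, h, mul_one]

lemma coeff_logarithmicDerivative (hS : coeff 0 S = 1) (k : ℕ) :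
    coeff k (logarithmicDerivative S) = coeff (k + 1) S * (k + 1) -
      ∑ j ∈ Finset.range k, coeff j (logarithmicDerivative S) * coeff (k - j) S := by
  have h := congrArg (coeff k) (derivative_eq_mul_logarithmicDerivative hS)
  rw [coeff_derivative, mul_comm S, coeff_mul, Finset.Nat.sum_antidiagonal_eq_sum_range_succ
    (fun i j => coeff i (logarithmicDerivative S) * coeff j S), Finset.sum_range_succ,
    Nat.sub_self, hS, mul_one] at h
  linarith

lemma isBigO_coeff_logarithmicDerivative {S : ℕ → ℝ⟦X⟧} (hS : ∀ i, coeff 0 (S i) = 1)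
    (hb : ∀ k, (fun i => coeff k (S i)) =O[⊤] fun _ => (1 : ℝ)) (k : ℕ) :
    (fun i => coeff k (logarithmicDerivative (S i))) =O[⊤] fun _ => (1 : ℝ) := by
  induction k using Nat.strong_induction_on with
  | _ k ih =>
  simp only [fun i => coeff_logarithmicDerivative (hS i) k]
  refine IsBigO.sub ?_ (IsBigO.fun_sum fun j hj => ?_)
  · simpa using (hb (k + 1)).mul (isBigO_const_const ((k : ℝ) + 1) one_ne_zero ⊤)
  · simpa using (ih j (Finset.mem_range.mp hj)).mul (hb (k - j))

lemma derivative_rescale (c : ℝ) (S : ℝ⟦X⟧) :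
    derivative ℝ (rescale c S) = C c * rescale c (derivative ℝ S) := by
  ext k
  simp only [coeff_derivative, coeff_C_mul, coeff_rescale]
  ring

lemma derivative_list_prod_rescale {S : ℕ → ℝ⟦X⟧} (hS : ∀ i, coeff 0 (S i) = 1) (c : ℝ) (n : ℕ) :
    derivative ℝ ((List.range n).map fun i => rescale c (S i)).prod =
      ((List.range n).map fun i => rescale c (S i)).prod *
        (C c * rescale c (∑ i ∈ Finset.range n, logarithmicDerivative (S i))) := by
  induction n with
  | zero => simp
  | succ n ih =>
    rw [List.prod_range_succ, Derivation.leibniz, ih, derivative_rescale,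
      derivative_eq_mul_logarithmicDerivative (hS n), Finset.sum_range_succ, map_add, map_mul,
      smul_eq_mul, smul_eq_mul]
    ring

lemma coeff_zero_list_prod_rescale {S : ℕ → ℝ⟦X⟧} (hS : ∀ i, coeff 0 (S i) = 1) (c : ℝ) (n : ℕ) :
    coeff 0 ((List.range n).map fun i => rescale c (S i)).prod = 1 := by
  induction n with
  | zero => simp
  | succ n ih =>
    rw [List.prod_range_succ, coeff_mul]
    simp [coeff_rescale, ih, hS]

lemma tendsto_coeff_rescaled_logarithmicDerivative {S : ℕ → ℝ⟦X⟧} {a : ℝ}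
    (hS0 : ∀ i, coeff 0 (S i) = 1) (hS1 : ∀ i, coeff 1 (S i) = 0) (hS2 : ∀ i, coeff 2 (S i) = a)
    (hb : ∀ k, (fun i => coeff k (S i)) =O[⊤] fun _ => (1 : ℝ)) (k : ℕ) :
    Tendsto (fun n : ℕ => coeff k (C (√n)⁻¹ * rescale (√n)⁻¹
      (∑ i ∈ Finset.range n, logarithmicDerivative (S i)))) atTop
      (𝓝 (coeff k (C (2 * a) * X : ℝ⟦X⟧))) := by
  have hl0 (i) : coeff 0 (logarithmicDerivative (S i)) = 0 := by
    rw [coeff_logarithmicDerivative (hS0 i)]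
    simp [hS1]
  have hl1 (i) : coeff 1 (logarithmicDerivative (S i)) = 2 * a := by
    rw [coeff_logarithmicDerivative (hS0 i)]
    simp [hS1, hS2]
    ring
  simp only [coeff_C_mul, coeff_rescale, map_sum]
  match k with
  | 0 => simp [hl0]
  | 1 =>
    refine tendsto_const_nhds.congr' ?_
    filter_upwards [eventually_gt_atTop 0] with n hn
    have hn : (0 : ℝ) < n := by exact_mod_cast hn
    have hs : (√n : ℝ) ^ 2 = n := Real.sq_sqrt hn.le
    simp only [hl1, Finset.sum_const, Finset.card_range, nsmul_eq_mul, coeff_one_X]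
    field_simp
    rw [hs]
  | k + 2 =>
    obtain ⟨B, hB⟩ := isBigO_top.mp (isBigO_coeff_logarithmicDerivative hS0 hb (k + 2))
    have hlim : Tendsto (fun n : ℕ => B * (√n)⁻¹) atTop (𝓝 0) := by
      simpa using ((Real.tendsto_sqrt_atTop.comp
        tendsto_natCast_atTop_atTop).inv_tendsto_atTop).const_mul B
    rw [coeff_X, if_neg (by omega), mul_zero]
    refine squeeze_zero_norm' ?_ hlim
    filter_upwards [eventually_gt_atTop 0] with n hn
    have hn1 : (1 : ℝ) ≤ n := by exact_mod_cast hn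
    have hs : (√n : ℝ) ^ 2 = n := Real.sq_sqrt (by positivity)
    have hs1 : 1 ≤ √n := Real.one_le_sqrt.mpr hn1
    have hB0 : 0 ≤ B := by simpa using (norm_nonneg _).trans (hB 0)
    have hsum : ‖∑ i ∈ Finset.range n, coeff (k + 2) (logarithmicDerivative (S i))‖ ≤ n * B := by
      refine (norm_sum_le_of_le _ fun i _ => hB i).trans_eq ?_
      simp
    have hpow : ((√n)⁻¹) ^ k ≤ 1 := pow_le_one₀ (by positivity) (inv_le_one_of_one_le₀ hs1)
    rw [← Finset.mul_sum, norm_mul, norm_mul, norm_pow,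
      Real.norm_of_nonneg (by positivity : (0 : ℝ) ≤ (√n)⁻¹)]
    calc (√n)⁻¹ * ((√n)⁻¹ ^ (k + 2) *
          ‖∑ i ∈ Finset.range n, coeff (k + 2) (logarithmicDerivative (S i))‖)
        ≤ (√n)⁻¹ * ((1 * (√n)⁻¹ ^ 2) * (n * B)) := by
          rw [pow_add]
          gcongr
      _ = B * (√n)⁻¹ := by
          rw [inv_pow, hs]
          field_simp

end PowerSeries

lemma derivative_hermite_succ (n : ℕ) :
    derivative (hermite (n + 1)) = (n + 1) * hermite n := by
  induction n with
  | zero => simp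
  | succ n ih =>
    have h := hermite_succ n
    rw [hermite_succ (n + 1), derivative_sub, derivative_mul, ih, derivative_mul, h]
    simp
    ring

lemma coeff_hermite_mul (n j : ℕ) :
    ((j : ℤ) + 2) * (j + 1) * (hermite n).coeff (j + 2) = (j - n) * (hermite n).coeff j := by
  have h : derivative (derivative (hermite n)) =
      X * derivative (hermite n) - C (n : ℤ) * hermite n := by
    have h1 := congrArg derivative (hermite_succ n)
    rw [derivative_hermite_succ, derivative_sub, derivative_mul] at h1
    simp only [derivative_X, one_mul] at h1
    rw [show (C (n : ℤ)) = (n : ℤ[X]) by simp]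
    linear_combination h1
  have h2 := congrArg (fun q => coeff q j) h
  cases j with
  | zero =>
    simp [coeff_derivative] at h2 ⊢
    linarith
  | succ j =>
    simp only [coeff_sub, coeff_X_mul, coeff_C_mul, coeff_derivative] at h2
    push_cast at h2 ⊢
    linarith

lemma coeff_derivative_derivativeSymbol_hermite {m k : ℕ} (hk : k < m) :
    PowerSeries.coeff k (PowerSeries.derivative ℝ
      (derivativeSymbol m ((hermite m).map (Int.castRingHom ℝ)))) =
    -PowerSeries.coeff k
      (PowerSeries.X * derivativeSymbol m ((hermite m).map (Int.castRingHom ℝ))) := by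
  rw [PowerSeries.coeff_derivative, coeff_derivativeSymbol hk]
  cases k with
  | zero =>
    have h : (hermite m).coeff (m - 1) = 0 := coeff_hermite_of_odd_add ⟨m - 1, by omega⟩
    simp [h]
  | succ k =>
    rw [PowerSeries.coeff_succ_X_mul, coeff_derivativeSymbol (by omega)]
    obtain ⟨j, rfl⟩ := Nat.exists_eq_add_of_le (show k + 2 ≤ m by omega)
    have h := congrArg (Int.cast : ℤ → ℝ) (coeff_hermite_mul (k + 2 + j) j)
    have h1 : k + 2 + j - (k + 1 + 1) = j := by omega
    have h2 : k + 2 + j - k = j + 2 := by omega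
    rw [h1, h2, coeff_map, coeff_map, Nat.factorial_succ, Nat.factorial_succ]
    push_cast at h ⊢
    simp only [eq_intCast]
    linear_combination (j.factorial : ℝ) / (k + 2 + j).factorial * h

lemma derivativeSymbol_finiteGaussian {m : ℕ} (hm : 2 ≤ m) {σ : ℝ} (hσ : 0 < σ) :
    derivativeSymbol m (finiteGaussian m σ) = PowerSeries.rescale (√(σ ^ 2 / ((m : ℝ) - 1)))
      (derivativeSymbol m ((hermite m).map (Int.castRingHom ℝ))) := by
  have hm' : (0 : ℝ) < m - 1 := by
    have : (2 : ℝ) ≤ m := by exact_mod_cast hm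
    linarith
  have h : √(((m : ℝ) - 1) / σ ^ 2) = (√(σ ^ 2 / ((m : ℝ) - 1)))⁻¹ := by
    rw [← Real.sqrt_inv, inv_div]
  have h0 : √(σ ^ 2 / ((m : ℝ) - 1)) ≠ 0 := (Real.sqrt_pos.mpr (by positivity)).ne'
  have := derivativeSymbol_dilate m ((hermite m).map (Int.castRingHom ℝ)) (inv_ne_zero h0)
  rwa [inv_pow, inv_inv, inv_inv, ← h] at this

lemma coeff_derivative_derivativeSymbol_finiteGaussian {m : ℕ} (hm : 2 ≤ m) {σ : ℝ} (hσ : 0 < σ)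
    {k : ℕ} (hk : k < m) :
    PowerSeries.coeff k (PowerSeries.derivative ℝ (derivativeSymbol m (finiteGaussian m σ))) =
      PowerSeries.coeff k (derivativeSymbol m (finiteGaussian m σ) *
        (PowerSeries.C (2 * (-σ ^ 2 / (2 * ((m : ℝ) - 1)))) * PowerSeries.X)) := by
  have hm' : (0 : ℝ) < m - 1 := by
    have : (2 : ℝ) ≤ m := by exact_mod_cast hm
    linarith
  have hs : √(σ ^ 2 / ((m : ℝ) - 1)) ^ 2 = σ ^ 2 / ((m : ℝ) - 1) := Real.sq_sqrt (by positivity)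
  have ha : 2 * (-σ ^ 2 / (2 * ((m : ℝ) - 1))) = -√(σ ^ 2 / ((m : ℝ) - 1)) ^ 2 := by
    rw [hs]
    field_simp
  rw [derivativeSymbol_finiteGaussian hm hσ, ha, PowerSeries.derivative_rescale,
    PowerSeries.coeff_C_mul, PowerSeries.coeff_rescale,
    coeff_derivative_derivativeSymbol_hermite hk,
    mul_left_comm (PowerSeries.rescale _ _), PowerSeries.coeff_C_mul, mul_comm _ PowerSeries.X]
  cases k with
  | zero => simp
  | succ k =>
    rw [PowerSeries.coeff_succ_X_mul, PowerSeries.coeff_succ_X_mul, PowerSeries.coeff_rescale]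
    ring

section RealRooted

variable {m : ℕ} {p : ℝ[X]}

lemma coeff_zero_derivativeSymbol (hmon : p.Monic) (hdeg : p.natDegree = m) :
    PowerSeries.coeff 0 (derivativeSymbol m p) = 1 := by
  rw [coeff_derivativeSymbol (Nat.zero_le m), Nat.sub_zero, ← hdeg, hmon.coeff_natDegree, one_mul,
    div_self (by positivity)]

lemma coeff_one_derivativeSymbol (hm : 1 ≤ m) (hdeg : p.natDegree = m)
    (hreal : Multiset.card p.roots = m) (hsum : p.roots.sum = 0) :
    PowerSeries.coeff 1 (derivativeSymbol m p) = 0 := by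
  rw [coeff_derivativeSymbol hm,
    coeff_eq_esymm_roots_of_card (hreal.trans hdeg.symm) (by omega), hdeg, Nat.sub_sub_self hm,
    Multiset.esymm_one_eq_sum, hsum]
  simp

lemma coeff_two_derivativeSymbol (hm : 2 ≤ m) (hmon : p.Monic) (hdeg : p.natDegree = m)
    (hreal : Multiset.card p.roots = m) (hsum : p.roots.sum = 0) {σ : ℝ}
    (hsq : (p.roots.map fun r => r ^ 2).sum = m * σ ^ 2) :
    PowerSeries.coeff 2 (derivativeSymbol m p) = -σ ^ 2 / (2 * ((m : ℝ) - 1)) := by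
  have he := Multiset.two_mul_esymm_two p.roots
  rw [hsum, hsq] at he
  have he : p.roots.esymm 2 = -(m * σ ^ 2) / 2 := by linarith
  rw [coeff_derivativeSymbol hm,
    coeff_eq_esymm_roots_of_card (hreal.trans hdeg.symm) (by omega), hdeg, Nat.sub_sub_self hm,
    hmon.leadingCoeff, he]
  obtain ⟨d, rfl⟩ := Nat.exists_eq_add_of_le' hm
  rw [Nat.add_sub_cancel, Nat.factorial_succ, Nat.factorial_succ]
  have h1 : (d : ℝ) + 2 - 1 = d + 1 := by ring
  push_cast
  rw [h1]
  field_simp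
  ring

lemma norm_coeff_le_of_sum_sq_roots (hmon : p.Monic) (hdeg : p.natDegree = m)
    (hreal : Multiset.card p.roots = m) {v : ℝ} (hsq : (p.roots.map fun r => r ^ 2).sum = v)
    (j : ℕ) : ‖p.coeff j‖ ≤ max (√v) 1 ^ m * m.choose (m / 2) := by
  have h := coeff_bdd_of_roots_le (RingHom.id ℝ) (B := √v) hmon
    (by rw [Polynomial.map_id]; exact splits_iff_card_roots.mpr (hreal.trans hdeg.symm))
    hdeg.le ?_ j
  · rwa [Polynomial.map_id] at h
  · intro z hz
    rw [Polynomial.map_id] at hz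
    refine Real.abs_le_sqrt ?_
    rw [← hsq]
    refine Multiset.single_le_sum (fun x hx => ?_) _ (Multiset.mem_map_of_mem _ hz)
    obtain ⟨r, -, rfl⟩ := Multiset.mem_map.mp hx
    positivity

end RealRooted

lemma isBigO_coeff_derivativeSymbol {m : ℕ} {p : ℕ → ℝ[X]} {B : ℝ}
    (hp : ∀ i j, ‖(p i).coeff j‖ ≤ B) (k : ℕ) :
    (fun i => PowerSeries.coeff k (derivativeSymbol m (p i))) =O[⊤] fun _ => (1 : ℝ) := by
  rcases le_or_gt k m with hk | hk
  · simp only [coeff_derivativeSymbol hk, mul_div_assoc]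
    have h : (fun i => (p i).coeff (m - k)) =O[⊤] fun _ => (1 : ℝ) :=
      isBigO_top.mpr ⟨B, fun i => by simpa using hp i (m - k)⟩
    simpa using h.mul
      (isBigO_const_const (((m - k).factorial : ℝ) / m.factorial) one_ne_zero ⊤)
  · simp only [coeff_derivativeSymbol_of_lt hk]
    exact isBigO_zero _ _

/-- **Finite free central limit theorem.** Let `σ > 0`, `m ≥ 2`, and let
`p_1, p_2, …` be monic real-rooted real polynomials of degree `m` whose roots sum to `0`
and whose roots have sum of squares `mσ²`. With `q_{i,n}(x) = n^{-m/2} p_i(√n · x)` and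
`r_n = [q_{1,n} ⊞_m ⋯ ⊞_m q_{n,n}]`, each coefficient of `r_n` converges to the
corresponding coefficient of `𝔑_m[0, σ²]`. -/
theorem finite_free_central_limit_theorem (m : ℕ) (hm : 2 ≤ m) (σ : ℝ) (hσ : 0 < σ)
    (p : ℕ → ℝ[X])
    (hmon : ∀ i, (p i).Monic) (hdeg : ∀ i, (p i).natDegree = m)
    (hreal : ∀ i, Multiset.card (p i).roots = m)
    (hsum : ∀ i, (p i).roots.sum = 0)
    (hsq : ∀ i, ((p i).roots.map fun r => r ^ 2).sum = m * σ ^ 2) :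
    ∀ j : ℕ, j ≤ m →
      Filter.Tendsto
        (fun n : ℕ =>
          (boxplusList m
            ((List.range n).map fun i =>
              C ((Real.sqrt n ^ m)⁻¹) *
                ((p (i + 1)).comp (C (Real.sqrt n) * X)))).coeff j)
        Filter.atTop
        (nhds ((finiteGaussian m σ).coeff j)) := by
  intro j hj
  set S : ℕ → ℝ⟦X⟧ := fun i => derivativeSymbol m (p (i + 1)) with hS
  have hS0 (i) : PowerSeries.coeff 0 (S i) = 1 := coeff_zero_derivativeSymbol (hmon _) (hdeg _)
  have hS1 (i) : PowerSeries.coeff 1 (S i) = 0 :=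
    coeff_one_derivativeSymbol (by omega) (hdeg _) (hreal _) (hsum _)
  have hS2 (i) : PowerSeries.coeff 2 (S i) = -σ ^ 2 / (2 * ((m : ℝ) - 1)) :=
    coeff_two_derivativeSymbol hm (hmon _) (hdeg _) (hreal _) (hsum _) (hsq _)
  have hb (k) : (fun i => PowerSeries.coeff k (S i)) =O[⊤] fun _ => (1 : ℝ) :=
    isBigO_coeff_derivativeSymbol (p := fun i => p (i + 1)) (fun i =>
      norm_coeff_le_of_sum_sq_roots (hmon (i + 1)) (hdeg _) (hreal _) (hsq _)) k
  have hG0 : PowerSeries.coeff 0 (derivativeSymbol m (finiteGaussian m σ)) = 1 := by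
    rw [derivativeSymbol_finiteGaussian hm hσ, PowerSeries.coeff_rescale, pow_zero, one_mul]
    exact coeff_zero_derivativeSymbol ((hermite_monic m).map _)
      (by rw [(hermite_monic m).natDegree_map, natDegree_hermite])
  have hlim := tendsto_coeff_of_derivative_eq_mul
    (F := fun n => ((List.range n).map fun i => PowerSeries.rescale (√n)⁻¹ (S i)).prod)
    (Eventually.of_forall fun n => PowerSeries.derivative_list_prod_rescale hS0 (√n)⁻¹ n)
    (by simp only [PowerSeries.coeff_zero_list_prod_rescale hS0, hG0, tendsto_const_nhds])
    (PowerSeries.tendsto_coeff_rescaled_logarithmicDerivative hS0 hS1 hS2 hb)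
    (fun k hk => coeff_derivative_derivativeSymbol_finiteGaussian hm hσ hk) (Nat.sub_le m j)
  have hcoeff (q : ℝ[X]) : PowerSeries.coeff (m - j) (derivativeSymbol m q) *
      (m.factorial / j.factorial) = q.coeff j := by
    rw [coeff_derivativeSymbol (Nat.sub_le m j), Nat.sub_sub_self hj]
    field_simp
  rw [← hcoeff]
  refine (hlim.mul_const _).congr' ?_
  filter_upwards [eventually_gt_atTop 0] with n hn
  have hs : √(n : ℝ) ≠ 0 := (Real.sqrt_pos.mpr (by exact_mod_cast hn)).ne'
  rw [← hcoeff, coeff_derivativeSymbol_boxplusList ?_ (Nat.sub_le m j), List.map_map]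
  · simp only [hS, Function.comp_def, derivativeSymbol_dilate m _ hs]
  · intro q hq
    obtain ⟨i, -, rfl⟩ := List.mem_map.mp hq
    refine (natDegree_C_mul_le _ _).trans (natDegree_comp_le.trans ?_)
    rw [hdeg, natDegree_C_mul_X _ hs, mul_one]
end
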